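/- Let Σ be a complete connected translating graph in a direction v_θ = sin θ·e₃ + cos θ·e₂ (θ ∈ [0,π)) which is not contained in any plane, and let N : Σ → S² be its Gauss map. Let E = {ν ∈ S² : ⟨ν, e₃⟩ = 0} be the equator and 𝓗 = N⁻¹(E) the zero set of the mean curvature of Σ. Then the image N(𝓗) is an open subset of E (in the subspace topology of E ⊆ S²). -/

import Mathlib

open MeasureTheory Metric Real EuclideanSpace
open scoped RealInnerProductSpace ENNReal NNReal

noncomputable section

abbrev E3 : Type := EuclideanSpace ℝ (Fin 3)

def e1 : E3 := EuclideanSpace.single 0 1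
def e2 : E3 := EuclideanSpace.single 1 1
def e3 : E3 := EuclideanSpace.single 2 1

/-- First partial derivative of `u` in the first variable. -/
def pds (u : ℝ × ℝ → ℝ) (p : ℝ × ℝ) : ℝ := fderiv ℝ u p (1, 0)

/-- First partial derivative of `u` in the second variable. -/
def pdt (u : ℝ × ℝ → ℝ) (p : ℝ × ℝ) : ℝ := fderiv ℝ u p (0, 1)

/-- `S` is a translating graph in the direction of the unit vector `v`, with respect to the
orthonormal basis `(a, b, v)` of `ℝ³`, over the open connected domain `Ω ⊆ ℝ²`, given by the
smooth function `u : Ω → ℝ` solving the translator equation. -/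
structure IsTranslatingGraph (a b v : E3) (Ω : Set (ℝ × ℝ)) (u : ℝ × ℝ → ℝ)
    (S : Set E3) : Prop where
  norm_a : ‖a‖ = 1
  norm_b : ‖b‖ = 1
  norm_v : ‖v‖ = 1
  inner_ab : ⟪a, b⟫ = 0
  inner_av : ⟪a, v⟫ = 0
  inner_bv : ⟪b, v⟫ = 0
  isOpen_dom : IsOpen Ω
  isConnected_dom : IsConnected Ω
  smooth : ContDiffOn ℝ (⊤ : ℕ∞) u Ω
  pde : ∀ p ∈ Ω,
    (1 + (pdt u p) ^ 2) * pds (fun q => pds u q) p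
      - 2 * pds u p * pdt u p * pdt (fun q => pds u q) p
      + (1 + (pds u p) ^ 2) * pdt (fun q => pdt u q) p
    = (1 + (pds u p) ^ 2 + (pdt u p) ^ 2) *
        (⟪e3, v⟫ - pds u p * ⟪e3, a⟫ - pdt u p * ⟪e3, b⟫)
  graph_eq : S = {q : E3 | ∃ p ∈ Ω, q = p.1 • a + p.2 • b + u p • v}

/-- Entropy of a surface. -/
def entropy (S : Set E3) : ℝ≥0∞ :=
  ⨆ (x₀ : E3) (s₀ : ℝ) (_ : 0 < s₀),
    (ENNReal.ofReal (4 * π * s₀))⁻¹ *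
      ∫⁻ q in S, ENNReal.ofReal (Real.exp (-‖q - x₀‖ ^ 2 / (4 * s₀))) ∂(μH[2])

/-- Number of connected components (as a cardinal). -/
def numComponents (A : Set E3) : Cardinal := Cardinal.mk (ConnectedComponents A)

def vθ (θ : ℝ) : E3 := Real.sin θ • e3 + Real.cos θ • e2
def bθ (θ : ℝ) : E3 := Real.cos θ • e3 - Real.sin θ • e2


/-- The point of the translating graph over parameter `p`, for the basis `(e₁, b_θ, v_θ)`. -/
def graphPtθ (θ : ℝ) (u : ℝ × ℝ → ℝ) (p : ℝ × ℝ) : E3 :=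
  p.1 • e1 + p.2 • bθ θ + u p • vθ θ

/-- The Gauss map of a translating graph in the direction `v_θ`, as a function of the
parameter `p ∈ Ω`: `N = (v_θ − u_s e₁ − u_t b_θ)/√(1+u_s²+u_t²)`. -/
def gaussMapθ (θ : ℝ) (u : ℝ × ℝ → ℝ) (p : ℝ × ℝ) : E3 :=
  (Real.sqrt (1 + (pds u p) ^ 2 + (pdt u p) ^ 2))⁻¹ •
    (vθ θ - pds u p • e1 - pdt u p • bθ θ)

section HelperLemmas

open Filter Topology
open scoped ContDiff

theorem quadratic_conformal_identity (c1 c2 g1 g2 w11 w12 w22 : ℝ) :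
    let p1 := c1 + g1
    let p2 := c2 + g2
    let l := -c2 * g1 + c1 * g2
    let S := g1 ^ 2 + g2 ^ 2 + l ^ 2
    let n1 := g1 - c2 * l
    let n2 := g2 + c1 * l
    let m1 := n1 * w11 + n2 * w12
    let m2 := n1 * w12 + n2 * w22
    let l1 := -c2 * w11 + c1 * w12
    let l2 := -c2 * w12 + c1 * w22
    let q1 := w11 ^ 2 + w12 ^ 2 + l1 ^ 2
    let q2 := w12 ^ 2 + w22 ^ 2 + l2 ^ 2
    let q12 := w11 * w12 + w12 * w22 + l1 * l2
    let f := (1 + p2 ^ 2) * w11 - 2 * p1 * p2 * w12 + (1 + p1 ^ 2) * w22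
    ((1 + p2 ^ 2) * q1 - 2 * p1 * p2 * q12 + (1 + p1 ^ 2) * q2) * S
      - 2 * ((1 + p2 ^ 2) * m1 ^ 2 - 2 * p1 * p2 * (m1 * m2) + (1 + p1 ^ 2) * m2 ^ 2)
    = f * (((1 + c2 ^ 2) * w11 - 2 * c1 * c2 * w12 + (1 + c1 ^ 2) * w22) * S
        - 2 * (n1 * m1 + n2 * m2))
      + (w11 * w22 - w12 ^ 2) * S * (2 * (g1 * c1 + g2 * c2) + S) := by
  intros
  ring

set_option maxHeartbeats 1000000 in
theorem hessian_le_of_gradient_log {P c1 c2 g1 g2 w11 w12 w22 f X1 X2 : ℝ} (hP : 1 ≤ P)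
    (hp1 : |c1 + g1| ≤ P) (hp2 : |c2 + g2| ≤ P)
    (hf : f = (1 + (c2 + g2) ^ 2) * w11 - 2 * (c1 + g1) * (c2 + g2) * w12
      + (1 + (c1 + g1) ^ 2) * w22)
    (hfg : |f| ≤ P * (|g1| + |g2|))
    {l S n1 n2 : ℝ} (hl : l = -c2 * g1 + c1 * g2) (hS : S = g1 ^ 2 + g2 ^ 2 + l ^ 2)
    (hn1 : n1 = g1 - c2 * l) (hn2 : n2 = g2 + c1 * l) (hS0 : 0 < S)
    (hX1 : S * X1 = 2 * (n1 * w11 + n2 * w12)) (hX2 : S * X2 = 2 * (n1 * w12 + n2 * w22)) :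
    |w11| + |w12| + |w22| ≤ 30 * P ^ 2 * (|g1| + |g2|) * (|X1| + |X2| + 1) := by
  obtain ⟨p1, hp1d⟩ : ∃ p, p = c1 + g1 := ⟨_, rfl⟩
  rw [← hp1d] at hp1 hf
  obtain ⟨p2, hp2d⟩ : ∃ p, p = c2 + g2 := ⟨_, rfl⟩
  rw [← hp2d] at hp2 hf
  obtain ⟨m1, hm1⟩ : ∃ m, m = n1 * w11 + n2 * w12 := ⟨_, rfl⟩
  rw [← hm1] at hX1
  obtain ⟨m2, hm2⟩ : ∃ m, m = n1 * w12 + n2 * w22 := ⟨_, rfl⟩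
  rw [← hm2] at hX2
  obtain ⟨a, ha⟩ : ∃ y, y = 1 + p2 ^ 2 := ⟨_, rfl⟩
  obtain ⟨b, hb⟩ : ∃ y, y = p1 * p2 := ⟨_, rfl⟩
  obtain ⟨c, hc⟩ : ∃ y, y = 1 + p1 ^ 2 := ⟨_, rfl⟩
  obtain ⟨D, hD⟩ : ∃ y, y = a * n2 ^ 2 + 2 * b * n1 * n2 + c * n1 ^ 2 := ⟨_, rfl⟩
  have e12 : D * w12 = a * n2 * m1 + c * n1 * m2 - f * (n1 * n2) := by
    rw [hD, hm1, hm2, hf, ha, hb, hc]; ring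
  have e11 : D * w11 = f * n2 ^ 2 + c * (n1 * m1 - n2 * m2) + 2 * b * n2 * m1 := by
    rw [hD, hm1, hm2, hf, ha, hb, hc]; ring
  have e22 : D * w22 = f * n1 ^ 2 + a * (n2 * m2 - n1 * m1) + 2 * b * n1 * m2 := by
    rw [hD, hm1, hm2, hf, ha, hb, hc]; ring
  obtain ⟨n, hn⟩ : ∃ y, y = |n1| + |n2| := ⟨_, rfl⟩
  obtain ⟨m, hm⟩ : ∃ y, y = |m1| + |m2| := ⟨_, rfl⟩
  set ρ := |g1| + |g2| with hρ
  set X := |X1| + |X2| with hX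
  have hn1n : |n1| ≤ n := by rw [hn]; linarith [abs_nonneg n2]
  have hn2n : |n2| ≤ n := by rw [hn]; linarith [abs_nonneg n1]
  have hm1m : |m1| ≤ m := by rw [hm]; linarith [abs_nonneg m2]
  have hm2m : |m2| ≤ m := by rw [hm]; linarith [abs_nonneg m1]
  have hn0 : 0 ≤ n := (abs_nonneg n1).trans hn1n
  have hm0 : 0 ≤ m := (abs_nonneg m1).trans hm1m
  have hρ0 : 0 ≤ ρ := by positivity
  have hX0 : 0 ≤ X := by positivity
  have hSρ : S ≤ ρ * n := by
    have : S = g1 * n1 + g2 * n2 := by rw [hS, hn1, hn2, hl]; ring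
    rw [this]
    calc g1 * n1 + g2 * n2 ≤ |g1| * |n1| + |g2| * |n2| := by
          rw [← abs_mul, ← abs_mul]; exact add_le_add (le_abs_self _) (le_abs_self _)
      _ ≤ ρ * n := by
          have h1 := mul_nonneg (abs_nonneg g1) (abs_nonneg n2)
          have h2 := mul_nonneg (abs_nonneg g2) (abs_nonneg n1)
          have h3 : ρ * n = |g1| * |n1| + |g2| * |n2| + |g1| * |n2| + |g2| * |n1| := by
            rw [hρ, hn]; ring
          linarith
  have hnpos : 0 < n := by
    rcases hn0.eq_or_lt with h | h
    · rw [← h] at hSρ; linarith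
    · exact h
  have hmX : 2 * m = S * X := by
    have h1 : 2 * |m1| = S * |X1| := by
      have := congrArg abs hX1
      rw [abs_mul, abs_mul, abs_of_pos hS0, abs_two] at this; linarith
    have h2 : 2 * |m2| = S * |X2| := by
      have := congrArg abs hX2
      rw [abs_mul, abs_mul, abs_of_pos hS0, abs_two] at this; linarith
    rw [hm, hX]; linarith
  have hm3 : 2 * m ≤ ρ * n * X := by rw [hmX]; gcongr
  have hDn : n ^ 2 ≤ 2 * D := by
    have h1 : n1 ^ 2 + n2 ^ 2 ≤ D := by
      have : D = n1 ^ 2 + n2 ^ 2 + (p2 * n2 + p1 * n1) ^ 2 := by rw [hD, ha, hb, hc]; ring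
      linarith [sq_nonneg (p2 * n2 + p1 * n1)]
    have h2 : n ^ 2 ≤ 2 * (n1 ^ 2 + n2 ^ 2) := by
      rw [hn, ← sq_abs n1, ← sq_abs n2]
      have := sq_nonneg (|n1| - |n2|)
      have e : 2 * (|n1| ^ 2 + |n2| ^ 2) = (|n1| + |n2|) ^ 2 + (|n1| - |n2|) ^ 2 := by ring
      linarith
    linarith
  have hp1' : p1 ^ 2 ≤ P ^ 2 := sq_le_sq' (by linarith [abs_le.1 hp1]) (abs_le.1 hp1).2
  have hp2' : p2 ^ 2 ≤ P ^ 2 := sq_le_sq' (by linarith [abs_le.1 hp2]) (abs_le.1 hp2).2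
  have hP2 : 1 ≤ P ^ 2 := one_le_pow₀ hP
  have haP : |a| ≤ 2 * P ^ 2 := by rw [abs_of_nonneg (by rw [ha]; positivity)]; linarith
  have hcP : |c| ≤ 2 * P ^ 2 := by rw [abs_of_nonneg (by rw [hc]; positivity)]; linarith
  have hbP : |2 * b| ≤ 2 * P ^ 2 := by
    rw [hb, abs_mul, abs_mul, abs_two, sq]; gcongr
  have key : ∀ w : ℝ, |D * w| ≤ |f| * n ^ 2 + 6 * P ^ 2 * (n * m) →
      |w| ≤ ρ * (6 * P ^ 2 * X + 2 * P) := by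
    intro w hw
    have h1 : n ^ 2 * |w| ≤ 2 * (|f| * n ^ 2 + 6 * P ^ 2 * (n * m)) := by
      rw [abs_mul] at hw
      calc n ^ 2 * |w| ≤ 2 * D * |w| := by gcongr
        _ ≤ 2 * (|D| * |w|) := by
            have := mul_le_mul_of_nonneg_right (le_abs_self D) (abs_nonneg w); linarith
        _ ≤ _ := by linarith
    have h2 : n ^ 2 * |w| ≤ n ^ 2 * (ρ * (6 * P ^ 2 * X + 2 * P)) := by
      calc _ ≤ _ := h1
        _ = 2 * |f| * n ^ 2 + 6 * P ^ 2 * n * (2 * m) := by ring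
        _ ≤ 2 * (P * ρ) * n ^ 2 + 6 * P ^ 2 * n * (ρ * n * X) := by gcongr
        _ = _ := by ring
    exact le_of_mul_le_mul_left h2 (by positivity)
  have t1 : ∀ {α x y : ℝ}, |α| ≤ 2 * P ^ 2 → |x| ≤ n → |y| ≤ m →
      |α * x * y| ≤ 2 * P ^ 2 * (n * m) := by
    intro α x y h1 h2 h3
    rw [abs_mul, abs_mul, mul_assoc]; gcongr
  have t2 : ∀ {x y : ℝ}, |x| ≤ n → |y| ≤ n → |f * (x * y)| ≤ |f| * n ^ 2 := by
    intro x y h1 h2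
    rw [abs_mul, abs_mul, sq]; gcongr
  have k12 := key w12 (by
    rw [e12]
    have a1 := t1 haP hn2n hm1m
    have a2 := t1 hcP hn1n hm2m
    have a3 := t2 hn1n hn2n
    have : 0 ≤ P ^ 2 * (n * m) := by positivity
    rw [abs_le] at a1 a2 a3 ⊢
    constructor <;> linarith [a1.1, a1.2, a2.1, a2.2, a3.1, a3.2])
  have k11 := key w11 (by
    rw [e11]
    have a1 := t1 hcP hn1n hm1m
    have a2 := t1 hcP hn2n hm2m
    have a3 := t2 hn2n hn2n
    have a4 := t1 hbP hn2n hm1m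
    rw [abs_le] at a1 a2 a3 a4 ⊢
    constructor <;> linarith [a1.1, a1.2, a2.1, a2.2, a3.1, a3.2, a4.1, a4.2])
  have k22 := key w22 (by
    rw [e22]
    have a1 := t1 haP hn1n hm1m
    have a2 := t1 haP hn2n hm2m
    have a3 := t2 hn1n hn1n
    have a4 := t1 hbP hn1n hm2m
    rw [abs_le] at a1 a2 a3 a4 ⊢
    constructor <;> linarith [a1.1, a1.2, a2.1, a2.2, a3.1, a3.2, a4.1, a4.2])
  have hPP : P ≤ P ^ 2 := by nlinarith
  have : ρ * (6 * P ^ 2 * X + 2 * P) ≤ 10 * P ^ 2 * ρ * (X + 1) := by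
    have h0 : 0 ≤ P ^ 2 * X := by positivity
    have : 6 * P ^ 2 * X + 2 * P ≤ 10 * P ^ 2 * (X + 1) := by linarith
    calc _ ≤ ρ * (10 * P ^ 2 * (X + 1)) := by gcongr
      _ = _ := by ring
  linarith

set_option maxHeartbeats 1000000 in
theorem log_gradient_operator_bound {P c1 c2 g1 g2 w11 w12 w22 E1 E2 f X1 X2 : ℝ} (hP : 1 ≤ P)
    (hc1 : |c1| ≤ P) (hc2 : |c2| ≤ P)
    (hp1 : |c1 + g1| ≤ P) (hp2 : |c2 + g2| ≤ P)
    (hw11 : |w11| ≤ P) (hw12 : |w12| ≤ P)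
    (hf : f = (1 + (c2 + g2) ^ 2) * w11 - 2 * (c1 + g1) * (c2 + g2) * w12
      + (1 + (c1 + g1) ^ 2) * w22)
    (hfg : |f| ≤ P * (|g1| + |g2|))
    (hE1 : |E1| ≤ P * (|w11| + |w12| + |w22|)) (hE2 : |E2| ≤ P * (|w11| + |w12| + |w22|))
    {l S n1 n2 : ℝ} (hl : l = -c2 * g1 + c1 * g2) (hS : S = g1 ^ 2 + g2 ^ 2 + l ^ 2)
    (hn1 : n1 = g1 - c2 * l) (hn2 : n2 = g2 + c1 * l) (hS0 : 0 < S)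
    (hX1 : S * X1 = 2 * (n1 * w11 + n2 * w12)) (hX2 : S * X2 = 2 * (n1 * w12 + n2 * w22)) :
    |2 * (f * (((1 + c2 ^ 2) * w11 - 2 * c1 * c2 * w12 + (1 + c1 ^ 2) * w22) * S
        - 2 * (n1 * (n1 * w11 + n2 * w12) + n2 * (n1 * w12 + n2 * w22)))
      + (w11 * w22 - w12 ^ 2) * S * (2 * (g1 * c1 + g2 * c2) + S)) / S ^ 2
      + 2 * (n1 * E1 + n2 * E2) / S| ≤ 12000 * P ^ 7 * (|X1| + |X2| + 1) := by
  have hη := hessian_le_of_gradient_log hP hp1 hp2 hf hfg hl hS hn1 hn2 hS0 hX1 hX2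
  clear hX1 hX2 hf
  set η := |w11| + |w12| + |w22| with hηd
  set ρ := |g1| + |g2| with hρ
  set X := |X1| + |X2| with hX
  have hg1 : |g1| ≤ ρ := by rw [hρ]; linarith [abs_nonneg g2]
  have hg2 : |g2| ≤ ρ := by rw [hρ]; linarith [abs_nonneg g1]
  have hη1 : |w11| ≤ η := by rw [hηd]; linarith [abs_nonneg w12, abs_nonneg w22]
  have hη2 : |w12| ≤ η := by rw [hηd]; linarith [abs_nonneg w11, abs_nonneg w22]
  have hη3 : |w22| ≤ η := by rw [hηd]; linarith [abs_nonneg w12, abs_nonneg w11]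
  have hη0 : 0 ≤ η := by positivity
  have hρ0 : 0 ≤ ρ := by positivity
  have hX0 : 0 ≤ X := by positivity
  have hP0 : 0 ≤ P := by linarith
  have hP2 : 1 ≤ P ^ 2 := one_le_pow₀ hP
  have hρ4 : ρ ≤ 4 * P := by
    have h1 : |g1| ≤ 2 * P := by
      have := abs_sub (c1 + g1) c1
      rw [add_sub_cancel_left] at this; linarith
    have h2 : |g2| ≤ 2 * P := by
      have := abs_sub (c2 + g2) c2
      rw [add_sub_cancel_left] at this; linarith
    linarith
  have hlρ : |l| ≤ P * ρ := by
    rw [hl]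
    calc |-c2 * g1 + c1 * g2| ≤ |c2| * |g1| + |c1| * |g2| := by
          refine (abs_add_le _ _).trans ?_
          rw [abs_mul, abs_mul, abs_neg]
      _ ≤ P * |g1| + P * |g2| := by gcongr
      _ = P * ρ := by rw [hρ]; ring
  have hn : ∀ {c g : ℝ}, |c| ≤ P → |g| ≤ ρ → |g| + |c * l| ≤ 2 * P ^ 2 * ρ := by
    intro c g h1 h2
    rw [abs_mul]
    calc |g| + |c| * |l| ≤ 1 * ρ + P * (P * ρ) := by rw [one_mul]; gcongr
      _ ≤ P ^ 2 * ρ + P * (P * ρ) := by gcongr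
      _ = _ := by ring
  have hn1' : |n1| ≤ 2 * P ^ 2 * ρ := by
    rw [hn1]; exact (abs_sub _ _).trans (hn hc2 hg1)
  have hn2' : |n2| ≤ 2 * P ^ 2 * ρ := by
    rw [hn2]; exact (abs_add_le _ _).trans (hn hc1 hg2)
  have hS1 : ρ ^ 2 ≤ 2 * S := by
    rw [hS, hρ, ← sq_abs g1, ← sq_abs g2]; 
    have e : 2 * (|g1| ^ 2 + |g2| ^ 2) = (|g1| + |g2|) ^ 2 + (|g1| - |g2|) ^ 2 := by ring
    linarith [sq_nonneg (|g1| - |g2|), sq_nonneg l]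
  have hS2 : S ≤ 2 * P ^ 2 * ρ ^ 2 := by
    have h1 : g1 ^ 2 + g2 ^ 2 ≤ ρ ^ 2 := by
      rw [hρ, ← sq_abs g1, ← sq_abs g2]; 
      have e : (|g1| + |g2|) ^ 2 = |g1| ^ 2 + |g2| ^ 2 + 2 * (|g1| * |g2|) := by ring
      linarith [mul_nonneg (abs_nonneg g1) (abs_nonneg g2)]
    have h2 : l ^ 2 ≤ (P * ρ) ^ 2 := sq_le_sq' (by linarith [abs_le.1 hlρ]) (abs_le.1 hlρ).2
    have h3 : 1 * ρ ^ 2 ≤ P ^ 2 * ρ ^ 2 := by gcongr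
    rw [mul_pow] at h2
    rw [hS]; linarith
  have hρpos : 0 < ρ := by
    rcases hρ0.eq_or_lt with h | h
    · rw [← h] at hS2; simp at hS2; linarith
    · exact h
  have hm : ∀ {x y : ℝ}, |x| + |y| ≤ η → |n1 * x + n2 * y| ≤ 2 * P ^ 2 * ρ * η := by
    intro x y h
    calc |n1 * x + n2 * y| ≤ |n1| * |x| + |n2| * |y| := by
          refine (abs_add_le _ _).trans ?_
          rw [abs_mul, abs_mul]
      _ ≤ 2 * P ^ 2 * ρ * |x| + 2 * P ^ 2 * ρ * |y| := by gcongr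
      _ = 2 * P ^ 2 * ρ * (|x| + |y|) := by ring
      _ ≤ _ := by gcongr
  have hm1 := hm (x := w11) (y := w12) (by rw [hηd]; linarith [abs_nonneg w22])
  have hm2 := hm (x := w12) (y := w22) (by rw [hηd]; linarith [abs_nonneg w11])
  generalize n1 * w11 + n2 * w12 = m1 at hm1 ⊢
  generalize n1 * w12 + n2 * w22 = m2 at hm2 ⊢
  obtain ⟨τ, hτ⟩ : ∃ y, y = (1 + c2 ^ 2) * w11 - 2 * c1 * c2 * w12 + (1 + c1 ^ 2) * w22 :=
    ⟨_, rfl⟩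
  rw [← hτ]
  have hc1' : c1 ^ 2 ≤ P ^ 2 := sq_le_sq' (by linarith [abs_le.1 hc1]) (abs_le.1 hc1).2
  have hc2' : c2 ^ 2 ≤ P ^ 2 := sq_le_sq' (by linarith [abs_le.1 hc2]) (abs_le.1 hc2).2
  have hτη : |τ| ≤ 2 * P ^ 2 * η := by
    have h1 : |(1 + c2 ^ 2) * w11| ≤ 2 * P ^ 2 * |w11| := by
      rw [abs_mul, abs_of_nonneg (by positivity : 0 ≤ 1 + c2 ^ 2)]; gcongr; linarith
    have h2 : |(1 + c1 ^ 2) * w22| ≤ 2 * P ^ 2 * |w22| := by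
      rw [abs_mul, abs_of_nonneg (by positivity : 0 ≤ 1 + c1 ^ 2)]; gcongr; linarith
    have h3 : |2 * c1 * c2 * w12| ≤ 2 * P ^ 2 * |w12| := by
      rw [abs_mul, abs_mul, abs_mul, abs_two, sq, ← mul_assoc]; gcongr
    calc |τ| ≤ |(1 + c2 ^ 2) * w11| + |2 * c1 * c2 * w12| + |(1 + c1 ^ 2) * w22| := by
          rw [hτ]; exact (abs_add_le _ _).trans (by gcongr; exact abs_sub _ _)
      _ ≤ _ := by rw [hηd]; linarith
  have hbr : |τ * S - 2 * (n1 * m1 + n2 * m2)| ≤ 20 * P ^ 4 * ρ ^ 2 * η := by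
    have h1 : |τ * S| ≤ 2 * P ^ 2 * η * (2 * P ^ 2 * ρ ^ 2) := by
      rw [abs_mul, abs_of_pos hS0]; gcongr
    have h2 : |n1 * m1| ≤ 2 * P ^ 2 * ρ * (2 * P ^ 2 * ρ * η) := by rw [abs_mul]; gcongr
    have h3 : |n2 * m2| ≤ 2 * P ^ 2 * ρ * (2 * P ^ 2 * ρ * η) := by rw [abs_mul]; gcongr
    rw [abs_le] at h1 h2 h3 ⊢
    constructor <;> linarith [h1.1, h1.2, h2.1, h2.2, h3.1, h3.2]
  have hdet : |w11 * w22 - w12 ^ 2| ≤ 2 * P * η := by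
    have h1 : |w11 * w22| ≤ P * η := by rw [abs_mul]; gcongr
    have h2 : |w12 ^ 2| ≤ P * η := by rw [sq, abs_mul]; gcongr
    calc _ ≤ |w11 * w22| + |w12 ^ 2| := abs_sub _ _
      _ ≤ _ := by linarith
  have hgc : |2 * (g1 * c1 + g2 * c2) + S| ≤ 10 * P ^ 3 * ρ := by
    have h1 : |g1 * c1| ≤ |g1| * P := by rw [abs_mul]; gcongr
    have h2 : |g2 * c2| ≤ |g2| * P := by rw [abs_mul]; gcongr
    have h3 : S ≤ 8 * P ^ 3 * ρ := by
      calc S ≤ 2 * P ^ 2 * (ρ * ρ) := by rw [← sq]; exact hS2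
        _ ≤ 2 * P ^ 2 * (4 * P * ρ) := by gcongr
        _ = _ := by ring
    have h4 : P * ρ ≤ P ^ 3 * ρ := by
      gcongr
      exact le_self_pow₀ hP (by norm_num)
    have h5 : |g1| * P + |g2| * P = P * ρ := by rw [hρ]; ring
    rw [abs_le] at h1 h2 ⊢
    constructor <;> linarith [h1.1, h1.2, h2.1, h2.2]
  have hnE : |n1 * E1 + n2 * E2| ≤ 4 * P ^ 3 * ρ * η := by
    have h1 : |n1 * E1| ≤ 2 * P ^ 2 * ρ * (P * η) := by rw [abs_mul]; gcongr
    have h2 : |n2 * E2| ≤ 2 * P ^ 2 * ρ * (P * η) := by rw [abs_mul]; gcongr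
    calc |n1 * E1 + n2 * E2| ≤ |n1 * E1| + |n2 * E2| := abs_add_le _ _
      _ ≤ 2 * P ^ 2 * ρ * (P * η) + 2 * P ^ 2 * ρ * (P * η) := add_le_add h1 h2
      _ = _ := by ring
  have F1 : |f * (τ * S - 2 * (n1 * m1 + n2 * m2))| ≤ 80 * P ^ 5 * η / ρ * S ^ 2 := by
    rw [abs_mul]
    calc |f| * |τ * S - 2 * (n1 * m1 + n2 * m2)|
        ≤ P * ρ * (20 * P ^ 4 * ρ ^ 2 * η) := by gcongr
      _ = 20 * P ^ 5 * η / ρ * (ρ ^ 2) ^ 2 := by field_simp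
      _ ≤ 20 * P ^ 5 * η / ρ * (2 * S) ^ 2 := by gcongr
      _ = _ := by ring
  have F2 : |(w11 * w22 - w12 ^ 2) * S * (2 * (g1 * c1 + g2 * c2) + S)|
      ≤ 40 * P ^ 5 * η / ρ * S ^ 2 := by
    rw [abs_mul, abs_mul, abs_of_pos hS0]
    calc |w11 * w22 - w12 ^ 2| * S * |2 * (g1 * c1 + g2 * c2) + S|
        ≤ 2 * P * η * S * (10 * P ^ 3 * ρ) := by gcongr
      _ = 20 * P ^ 4 * η / ρ * S * ρ ^ 2 := by field_simp; ring
      _ ≤ 20 * P ^ 4 * η / ρ * S * (2 * S) := by gcongr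
      _ = 40 * P ^ 4 * η / ρ * S ^ 2 := by ring
      _ ≤ _ := by gcongr <;> norm_num
  have F3 : |n1 * E1 + n2 * E2| ≤ 8 * P ^ 5 * η / ρ * S := by
    calc _ ≤ 4 * P ^ 3 * ρ * η := hnE
      _ = 4 * P ^ 3 * η / ρ * ρ ^ 2 := by field_simp
      _ ≤ 4 * P ^ 3 * η / ρ * (2 * S) := by gcongr
      _ = 8 * P ^ 3 * η / ρ * S := by ring
      _ ≤ _ := by gcongr <;> norm_num
  set V1 := f * (τ * S - 2 * (n1 * m1 + n2 * m2))
  set V2 := (w11 * w22 - w12 ^ 2) * S * (2 * (g1 * c1 + g2 * c2) + S)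
  set V3 := n1 * E1 + n2 * E2
  have G1 : |2 * (V1 + V2) / S ^ 2| ≤ 240 * P ^ 5 * η / ρ := by
    rw [abs_div, abs_of_pos (by positivity : 0 < S ^ 2), div_le_iff₀ (by positivity), abs_mul,
      abs_two]
    have := abs_add_le V1 V2
    calc 2 * |V1 + V2| ≤ 2 * (80 * P ^ 5 * η / ρ * S ^ 2 + 40 * P ^ 5 * η / ρ * S ^ 2) := by linarith
      _ = _ := by ring
  have G2 : |2 * V3 / S| ≤ 16 * P ^ 5 * η / ρ := by
    rw [abs_div, abs_of_pos hS0, div_le_iff₀ hS0, abs_mul, abs_two]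
    calc 2 * |V3| ≤ 2 * (8 * P ^ 5 * η / ρ * S) := by linarith
      _ = _ := by ring
  calc _ ≤ |2 * (V1 + V2) / S ^ 2| + |2 * V3 / S| := abs_add_le _ _
    _ ≤ 256 * P ^ 5 * η / ρ := by
        have : 240 * P ^ 5 * η / ρ + 16 * P ^ 5 * η / ρ = 256 * P ^ 5 * η / ρ := by ring
        linarith
    _ ≤ 256 * P ^ 5 * (30 * P ^ 2 * ρ * (X + 1)) / ρ := by gcongr
    _ = 7680 * P ^ 7 * (X + 1) := by field_simp; ring
    _ ≤ _ := by gcongr; norm_num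

set_option maxHeartbeats 1000000 in
theorem logarithmic_barrier_bound {P κ c1 c2 g1 g2 z1 z2 r : ℝ} (hP : 1 ≤ P) (hκ : 0 ≤ κ)
    (hc1 : |c1| ≤ P) (hc2 : |c2| ≤ P) (hr : 0 < r) (hr1 : r ≤ 1)
    (hg1 : |g1| ≤ P * r) (hg2 : |g2| ≤ P * r)
    (hq : r ^ 2 = z1 ^ 2 + z2 ^ 2 + (c1 * z1 + c2 * z2) ^ 2)
    {y1 y2 β₁ β₂ : ℝ} (hy1 : y1 = z1 + c1 * (c1 * z1 + c2 * z2))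
    (hy2 : y2 = z2 + c2 * (c1 * z1 + c2 * z2))
    (hβ₁ : β₁ = -1 / (2 * r ^ 2) + κ / (2 * r)) (hβ₂ : β₂ = 1 / (2 * r ^ 4) - κ / (4 * r ^ 3)) :
    κ / r - 74 * P ^ 4 * (1 / r + κ) ≤
      4 * β₂ * ((1 + (c2 + g2) ^ 2) * y1 ^ 2 - 2 * (c1 + g1) * (c2 + g2) * (y1 * y2)
        + (1 + (c1 + g1) ^ 2) * y2 ^ 2)
      + 2 * β₁ * ((1 + (c2 + g2) ^ 2) * (1 + c1 ^ 2) - 2 * (c1 + g1) * (c2 + g2) * (c1 * c2)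
        + (1 + (c1 + g1) ^ 2) * (1 + c2 ^ 2)) ∧
    |2 * β₁ * y1| ≤ 74 * P ^ 4 * (1 / r + κ) ∧ |2 * β₁ * y2| ≤ 74 * P ^ 4 * (1 / r + κ) := by
  obtain ⟨L, hL⟩ : ∃ L, L = c1 * z1 + c2 * z2 := ⟨_, rfl⟩
  obtain ⟨G, hG⟩ : ∃ G, G = -g2 * y1 + g1 * y2 := ⟨_, rfl⟩
  obtain ⟨H, hH⟩ : ∃ H, H = -c2 * z1 + c1 * z2 := ⟨_, rfl⟩
  obtain ⟨e1, he1⟩ : ∃ e, e = 2 * H * G + G ^ 2 := ⟨_, rfl⟩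
  obtain ⟨e2, he2⟩ : ∃ e, e = 2 * (c1 * g1 + c2 * g2) + g1 ^ 2 + g2 ^ 2 + (-g2 * c1 + g1 * c2) ^ 2 :=
    ⟨_, rfl⟩
  have split : 4 * β₂ * ((1 + (c2 + g2) ^ 2) * y1 ^ 2 - 2 * (c1 + g1) * (c2 + g2) * (y1 * y2)
        + (1 + (c1 + g1) ^ 2) * y2 ^ 2)
      + 2 * β₁ * ((1 + (c2 + g2) ^ 2) * (1 + c1 ^ 2) - 2 * (c1 + g1) * (c2 + g2) * (c1 * c2)
        + (1 + (c1 + g1) ^ 2) * (1 + c2 ^ 2))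
      = 4 * (1 + c1 ^ 2 + c2 ^ 2) * (β₂ * r ^ 2 + β₁) + 4 * β₂ * e1 + 2 * β₁ * e2 := by
    rw [hq, he1, he2, hG, hH, hy1, hy2]; ring
  have main : β₂ * r ^ 2 + β₁ = κ / (4 * r) := by
    rw [hβ₁, hβ₂]; field_simp; ring
  have hP0 : 0 ≤ P := by linarith
  have hz1 : |z1| ≤ r := abs_le_of_sq_le_sq (by rw [hq]; linarith [sq_nonneg z2, sq_nonneg (c1 * z1 + c2 * z2)]) hr.le
  have hz2 : |z2| ≤ r := abs_le_of_sq_le_sq (by rw [hq]; linarith [sq_nonneg z1, sq_nonneg (c1 * z1 + c2 * z2)]) hr.le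
  have hLr : |L| ≤ r := abs_le_of_sq_le_sq (by rw [hq, ← hL]; linarith [sq_nonneg z1, sq_nonneg z2]) hr.le
  rw [← hL] at hy1 hy2
  have hy : ∀ {z c : ℝ}, |z| ≤ r → |c| ≤ P → |z + c * L| ≤ 2 * P * r := by
    intro z c h1 h2
    calc |z + c * L| ≤ |z| + |c| * |L| := by rw [← abs_mul]; exact abs_add_le _ _
      _ ≤ 1 * r + P * r := by rw [one_mul]; gcongr
      _ ≤ P * r + P * r := by gcongr
      _ = _ := by ring
  have hy1' : |y1| ≤ 2 * P * r := by rw [hy1]; exact hy hz1 hc1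
  have hy2' : |y2| ≤ 2 * P * r := by rw [hy2]; exact hy hz2 hc2
  have hG' : |G| ≤ 4 * P ^ 2 * r ^ 2 := by
    calc |G| ≤ |g2| * |y1| + |g1| * |y2| := by
          rw [hG, ← abs_neg g2, ← abs_mul, ← abs_mul]; exact abs_add_le _ _
      _ ≤ P * r * (2 * P * r) + P * r * (2 * P * r) := by gcongr
      _ = _ := by ring
  have hH' : |H| ≤ 2 * P * r := by
    calc |H| ≤ |c2| * |z1| + |c1| * |z2| := by
          rw [hH, ← abs_neg c2, ← abs_mul, ← abs_mul]; exact abs_add_le _ _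
      _ ≤ P * r + P * r := by gcongr
      _ = _ := by ring
  have he1' : |e1| ≤ 32 * P ^ 4 * r ^ 3 := by
    calc |e1| ≤ 2 * |H| * |G| + |G| ^ 2 := by
          rw [he1, ← abs_two, ← abs_mul, ← abs_mul, ← abs_pow, abs_two]; exact abs_add_le _ _
      _ ≤ 2 * (2 * P * r) * (4 * P ^ 2 * r ^ 2) + (4 * P ^ 2 * r ^ 2) ^ 2 := by gcongr
      _ = 16 * P ^ 3 * r ^ 3 + 16 * P ^ 4 * (r * r ^ 3) := by ring
      _ ≤ 16 * P ^ 4 * r ^ 3 + 16 * P ^ 4 * (1 * r ^ 3) := by gcongr; norm_num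
      _ = _ := by ring
  have he2' : |e2| ≤ 10 * P ^ 4 * r := by
    calc |e2| ≤ 2 * (|c1| * |g1| + |c2| * |g2|) + |g1| ^ 2 + |g2| ^ 2
          + (|g2| * |c1| + |g1| * |c2|) ^ 2 := by
          rw [he2]
          have h1 : |-g2 * c1 + g1 * c2| ≤ |g2| * |c1| + |g1| * |c2| := by
            rw [← abs_neg g2, ← abs_mul, ← abs_mul]; exact abs_add_le _ _
          have h2 : |c1 * g1 + c2 * g2| ≤ |c1| * |g1| + |c2| * |g2| := by
            rw [← abs_mul, ← abs_mul]; exact abs_add_le _ _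
          refine (abs_add_le _ _).trans (add_le_add ((abs_add_le _ _).trans (add_le_add
            ((abs_add_le _ _).trans (add_le_add ?_ ?_)) ?_)) ?_)
          · rw [abs_mul, abs_two]; gcongr
          · rw [abs_pow]
          · rw [abs_pow]
          · rw [abs_pow]; gcongr
      _ ≤ 2 * (P * (P * r) + P * (P * r)) + (P * r) ^ 2 + (P * r) ^ 2
          + (P * r * P + P * r * P) ^ 2 := by gcongr
      _ = 4 * (P ^ 2 * r) + 2 * (P ^ 2 * (r * r)) + 4 * P ^ 4 * (r * r) := by ring
      _ ≤ 4 * (P ^ 4 * r) + 2 * (P ^ 4 * (1 * r)) + 4 * P ^ 4 * (1 * r) := by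
          gcongr <;> norm_num
      _ = _ := by ring
  have hA : 0 ≤ 1 / r + κ := by positivity
  have hβ₁' : |β₁| ≤ (1 / r + κ) / (2 * r) := by
    have : (1 / r + κ) / (2 * r) = 1 / (2 * r ^ 2) + κ / (2 * r) := by field_simp
    have h1 : 0 ≤ 1 / (2 * r ^ 2) := by positivity
    have h2 : 0 ≤ κ / (2 * r) := by positivity
    rw [this, hβ₁, neg_div, abs_le]; constructor <;> linarith
  have hβ₂' : |β₂| ≤ (1 / r + κ) / (2 * r ^ 3) := by
    have : (1 / r + κ) / (2 * r ^ 3) = 1 / (2 * r ^ 4) + κ / (2 * r ^ 3) := by field_simp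
    have h1 : 0 ≤ 1 / (2 * r ^ 4) := by positivity
    have h2 : 0 ≤ κ / (4 * r ^ 3) := by positivity
    have h3 : κ / (2 * r ^ 3) = 2 * (κ / (4 * r ^ 3)) := by field_simp; norm_num
    rw [this, hβ₂, h3, abs_le]; constructor <;> linarith
  have hPP : P ≤ P ^ 4 := le_self_pow₀ hP (by norm_num)
  have hgrad : ∀ {y : ℝ}, |y| ≤ 2 * P * r → |2 * β₁ * y| ≤ 74 * P ^ 4 * (1 / r + κ) := by
    intro y h
    rw [abs_mul, abs_mul, abs_two]
    calc 2 * |β₁| * |y| ≤ 2 * ((1 / r + κ) / (2 * r)) * (2 * P * r) := by gcongr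
      _ = 2 * P * (1 / r + κ) := by field_simp
      _ ≤ 74 * P ^ 4 * (1 / r + κ) := by gcongr; norm_num
  refine ⟨?_, hgrad hy1', hgrad hy2'⟩
  rw [split, main]
  have f1 : |4 * β₂ * e1| ≤ 64 * P ^ 4 * (1 / r + κ) := by
    rw [abs_mul, abs_mul, abs_of_pos (by norm_num : (0 : ℝ) < 4)]
    calc 4 * |β₂| * |e1| ≤ 4 * ((1 / r + κ) / (2 * r ^ 3)) * (32 * P ^ 4 * r ^ 3) := by gcongr
      _ = _ := by field_simp; norm_num
  have f2 : |2 * β₁ * e2| ≤ 10 * P ^ 4 * (1 / r + κ) := by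
    rw [abs_mul, abs_mul, abs_two]
    calc 2 * |β₁| * |e2| ≤ 2 * ((1 / r + κ) / (2 * r)) * (10 * P ^ 4 * r) := by gcongr
      _ = _ := by field_simp
  have f3 : κ / r ≤ 4 * (1 + c1 ^ 2 + c2 ^ 2) * (κ / (4 * r)) := by
    have : 4 * (1 + c1 ^ 2 + c2 ^ 2) * (κ / (4 * r)) = κ / r + (c1 ^ 2 + c2 ^ 2) * (κ / r) := by
      field_simp; ring
    have h2 : 0 ≤ (c1 ^ 2 + c2 ^ 2) * (κ / r) := by positivity
    linarith
  linarith [(abs_le.1 f1).1, (abs_le.1 f2).1]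

/-- `h` is twice differentiable along the line at `0`, with derivatives `a` and `b`. -/
def HasTwoJet (h : ℝ → ℝ) (a b : ℝ) : Prop :=
  ∃ h' : ℝ → ℝ, (∀ᶠ t in 𝓝 0, HasDerivAt h (h' t) t) ∧ h' 0 = a ∧ HasDerivAt h' b 0

namespace HasTwoJet

variable {h k : ℝ → ℝ} {a b c d : ℝ}

theorem congr_jet (hh : HasTwoJet h a b) (ha : a = c) (hb : b = d) : HasTwoJet h c d :=
  ha ▸ hb ▸ hh

theorem const (c : ℝ) : HasTwoJet (fun _ => c) 0 0 :=
  ⟨fun _ => 0, .of_forall fun t => hasDerivAt_const t c, rfl, hasDerivAt_const 0 0⟩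

theorem affine (c m : ℝ) : HasTwoJet (fun t => c + t * m) m 0 :=
  ⟨fun _ => m, .of_forall fun t => by simpa using ((hasDerivAt_id t).mul_const m).const_add c, rfl,
    hasDerivAt_const 0 m⟩

theorem add (hh : HasTwoJet h a b) (hk : HasTwoJet k c d) :
    HasTwoJet (fun t => h t + k t) (a + c) (b + d) := by
  obtain ⟨h', h1, h2, h3⟩ := hh
  obtain ⟨k', k1, k2, k3⟩ := hk
  refine ⟨fun t => h' t + k' t, ?_, by simp [h2, k2], h3.add k3⟩
  filter_upwards [h1, k1] with t h1 k1 using h1.add k1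

theorem neg (hh : HasTwoJet h a b) : HasTwoJet (fun t => -h t) (-a) (-b) := by
  obtain ⟨h', h1, h2, h3⟩ := hh
  exact ⟨fun t => -h' t, h1.mono fun t h => h.neg, by simp [h2], h3.neg⟩

theorem mul (hh : HasTwoJet h a b) (hk : HasTwoJet k c d) :
    HasTwoJet (fun t => h t * k t) (a * k 0 + h 0 * c) (b * k 0 + 2 * (a * c) + h 0 * d) := by
  obtain ⟨h', h1, rfl, h3⟩ := hh
  obtain ⟨k', k1, rfl, k3⟩ := hk
  refine ⟨fun t => h' t * k t + h t * k' t, ?_, rfl, ?_⟩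
  · filter_upwards [h1, k1] with t h1 k1 using h1.mul k1
  · exact ((h3.mul k1.self_of_nhds).add (h1.self_of_nhds.mul k3)).congr_deriv (by ring)

theorem const_mul (m : ℝ) (hh : HasTwoJet h a b) :
    HasTwoJet (fun t => m * h t) (m * a) (m * b) :=
  ((const m).mul hh).congr_jet (by ring) (by ring)

theorem sum {ι : Type*} {s : Finset ι} {f : ι → ℝ → ℝ} {A B : ι → ℝ}
    (hf : ∀ i ∈ s, HasTwoJet (f i) (A i) (B i)) :
    HasTwoJet (fun t => ∑ i ∈ s, f i t) (∑ i ∈ s, A i) (∑ i ∈ s, B i) := by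
  classical
  induction s using Finset.induction_on with
  | empty => simpa using const 0
  | insert i s hi ih =>
    simp only [Finset.sum_insert hi]
    exact (hf i (by simp)).add (ih fun j hj => hf j (by simp [hj]))

theorem comp (hh : HasTwoJet h a b) {F F' : ℝ → ℝ} {F'' : ℝ}
    (hF : ∀ᶠ y in 𝓝 (h 0), HasDerivAt F (F' y) y) (hF' : HasDerivAt F' F'' (h 0)) :
    HasTwoJet (fun t => F (h t)) (F' (h 0) * a) (F'' * a ^ 2 + F' (h 0) * b) := by
  obtain ⟨h', h1, rfl, h3⟩ := hh
  have hc : ContinuousAt h 0 := h1.self_of_nhds.continuousAt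
  refine ⟨fun t => F' (h t) * h' t, ?_, rfl, ?_⟩
  · filter_upwards [h1, hc.eventually hF] with t h1 hF using hF.comp t h1
  · exact ((hF'.comp 0 h1.self_of_nhds).mul h3).congr_deriv (by simp only [Function.comp]; ring)

theorem log (hh : HasTwoJet h a b) (h0 : h 0 ≠ 0) :
    HasTwoJet (fun t => Real.log (h t)) (a / h 0) (b / h 0 - (a / h 0) ^ 2) := by
  have hF : ∀ᶠ y in 𝓝 (h 0), HasDerivAt Real.log y⁻¹ y := by
    filter_upwards [isOpen_ne.mem_nhds h0] with y hy using Real.hasDerivAt_log hy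
  refine (hh.comp hF (hasDerivAt_inv h0)).congr_jet ?_ ?_
  · field_simp
  · field_simp; ring

theorem log_barrier (hh : HasTwoJet h a b) (κ : ℝ) {r : ℝ} (hr : 0 < r) (h0 : h 0 = r ^ 2) :
    HasTwoJet (fun t => -(1 / 2) * Real.log (h t) + κ * √(h t))
      ((-1 / (2 * r ^ 2) + κ / (2 * r)) * a)
      ((1 / (2 * r ^ 4) - κ / (4 * r ^ 3)) * a ^ 2 + (-1 / (2 * r ^ 2) + κ / (2 * r)) * b) := by
  have hs : √(h 0) = r := by rw [h0, Real.sqrt_sq hr.le]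
  have hpos : 0 < h 0 := by rw [h0]; positivity
  have hF : ∀ᶠ y in 𝓝 (h 0), HasDerivAt Real.sqrt (1 / (2 * √y)) y := by
    filter_upwards [isOpen_ne.mem_nhds hpos.ne'] with y hy using Real.hasDerivAt_sqrt hy
  have hF' : HasDerivAt (fun y => 1 / (2 * √y)) (-1 / (4 * r ^ 3)) (h 0) := by
    have h2 := (((Real.hasDerivAt_sqrt hpos.ne').const_mul 2).inv (by rw [hs]; positivity)).congr_deriv
      (g' := -1 / (4 * r ^ 3)) (by rw [hs]; field_simp; norm_num)
    refine h2.congr_of_eventuallyEq (.of_forall fun y => ?_)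
    simp
  have h1 := ((hh.log hpos.ne').const_mul (-(1 / 2))).add ((hh.comp hF hF').const_mul κ)
  refine h1.congr_jet ?_ ?_
  · rw [hs, h0]; field_simp
  · rw [hs, h0]; field_simp; ring

/-- Second derivative test at a local maximum. -/
theorem of_isLocalMax (hh : HasTwoJet h a b) (hm : IsLocalMax h 0) : a = 0 ∧ b ≤ 0 := by
  obtain ⟨h', h1, rfl, h3⟩ := hh
  have h0 : h' 0 = 0 := hm.hasDerivAt_eq_zero h1.self_of_nhds
  refine ⟨h0, ?_⟩
  by_contra! hb
  have hd : deriv h =ᶠ[𝓝 0] h' := h1.mono fun t ht => ht.deriv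
  have hmin : IsLocalMin h 0 := by
    apply isLocalMin_of_deriv_deriv_pos
    · rwa [hd.deriv_eq, h3.deriv]
    · rw [hd.eq_of_nhds, h0]
    · exact h1.self_of_nhds.continuousAt
  have hconst : h =ᶠ[𝓝 0] fun _ => h 0 := by
    filter_upwards [hm, hmin] with t ht1 ht2 using le_antisymm ht1 ht2
  have hd' : deriv h =ᶠ[𝓝 0] fun _ => 0 := by
    simpa using hconst.deriv
  have := (hd'.symm.trans hd).deriv_eq
  rw [h3.deriv, deriv_const] at this
  exact hb.ne this

end HasTwoJet


variable {Ω : Set (ℝ × ℝ)} {f g : ℝ × ℝ → ℝ} {x : ℝ × ℝ}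

theorem fderiv_eq_partials (f : ℝ × ℝ → ℝ) (x v : ℝ × ℝ) :
    fderiv ℝ f x v = v.1 * pds f x + v.2 * pdt f x := by
  have hv : v = v.1 • ((1, 0) : ℝ × ℝ) + v.2 • ((0, 1) : ℝ × ℝ) := by ext <;> simp
  conv_lhs => rw [hv]
  rw [map_add, map_smul, map_smul]
  rfl

theorem contDiffOn_pds (hΩ : IsOpen Ω) (hf : ContDiffOn ℝ ∞ f Ω) : ContDiffOn ℝ ∞ (pds f) Ω :=
  (hf.fderiv_of_isOpen hΩ le_rfl).clm_apply contDiffOn_const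

theorem contDiffOn_pdt (hΩ : IsOpen Ω) (hf : ContDiffOn ℝ ∞ f Ω) : ContDiffOn ℝ ∞ (pdt f) Ω :=
  (hf.fderiv_of_isOpen hΩ le_rfl).clm_apply contDiffOn_const

theorem hasDerivAt_line (hΩ : IsOpen Ω) (hf : ContDiffOn ℝ ∞ f Ω) (v : ℝ × ℝ) {t : ℝ}
    (hx : x + t • v ∈ Ω) :
    HasDerivAt (fun t : ℝ => f (x + t • v))
      (v.1 * pds f (x + t • v) + v.2 * pdt f (x + t • v)) t := by
  have hd : DifferentiableAt ℝ f (x + t • v) :=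
    (hf.contDiffAt (hΩ.mem_nhds hx)).differentiableAt (by simp)
  have hl : HasDerivAt (fun t : ℝ => x + t • v) v t := by
    simpa using ((hasDerivAt_id t).smul_const v).const_add x
  rw [← fderiv_eq_partials]
  exact hd.hasFDerivAt.comp_hasDerivAt t hl

theorem pds_pdt_comm (hΩ : IsOpen Ω) (hf : ContDiffOn ℝ ∞ f Ω) (hx : x ∈ Ω) :
    pds (pdt f) x = pdt (pds f) x := by
  have hc : ContDiffAt ℝ ∞ f x := hf.contDiffAt (hΩ.mem_nhds hx)
  have hs : IsSymmSndFDerivAt ℝ f x :=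
    hc.isSymmSndFDerivAt (by rw [minSmoothness_of_isRCLikeNormedField]; exact ENat.LEInfty.out)
  have hd : DifferentiableAt ℝ (fderiv ℝ f) x :=
    ((hf.fderiv_of_isOpen hΩ (m := ∞) le_rfl).contDiffAt (hΩ.mem_nhds hx)).differentiableAt
      (by simp)
  have key : ∀ v w : ℝ × ℝ, fderiv ℝ (fun y => fderiv ℝ f y v) x w
      = fderiv ℝ (fderiv ℝ f) x w v := by
    intro v w
    rw [fderiv_clm_apply hd (differentiableAt_const v)]
    simp
  exact (key _ _).trans ((hs _ _).trans (key _ _).symm)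

theorem eventually_line_mem (hΩ : IsOpen Ω) (hx : x ∈ Ω) (v : ℝ × ℝ) :
    ∀ᶠ t : ℝ in 𝓝 0, x + t • v ∈ Ω := by
  have hc : ContinuousAt (fun t : ℝ => x + t • v) 0 := by fun_prop
  exact hc.eventually (by simpa using hΩ.mem_nhds hx)

theorem hasTwoJet_line (hΩ : IsOpen Ω) (hf : ContDiffOn ℝ ∞ f Ω) (hx : x ∈ Ω) (v : ℝ × ℝ) :
    HasTwoJet (fun t : ℝ => f (x + t • v)) (v.1 * pds f x + v.2 * pdt f x)
      (v.1 ^ 2 * pds (pds f) x + 2 * v.1 * v.2 * pdt (pds f) x + v.2 ^ 2 * pdt (pdt f) x) := by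
  refine ⟨fun t => v.1 * pds f (x + t • v) + v.2 * pdt f (x + t • v), ?_, by simp, ?_⟩
  · filter_upwards [eventually_line_mem hΩ hx v] with t ht using hasDerivAt_line hΩ hf v ht
  · have hx0 : x + (0 : ℝ) • v ∈ Ω := by simpa using hx
    have h1 := hasDerivAt_line hΩ (contDiffOn_pds hΩ hf) v hx0
    have h2 := hasDerivAt_line hΩ (contDiffOn_pdt hΩ hf) v hx0
    refine ((h1.const_mul v.1).add (h2.const_mul v.2)).congr_deriv ?_
    rw [zero_smul, add_zero, pds_pdt_comm hΩ hf hx]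
    ring

theorem pds_congr (hΩ : IsOpen Ω) (h : ∀ y ∈ Ω, f y = g y) (hx : x ∈ Ω) : pds f x = pds g x := by
  have : f =ᶠ[𝓝 x] g := by filter_upwards [hΩ.mem_nhds hx] with y hy using h y hy
  rw [pds, pds, this.fderiv_eq]

theorem pdt_congr (hΩ : IsOpen Ω) (h : ∀ y ∈ Ω, f y = g y) (hx : x ∈ Ω) : pdt f x = pdt g x := by
  have : f =ᶠ[𝓝 x] g := by filter_upwards [hΩ.mem_nhds hx] with y hy using h y hy
  rw [pdt, pdt, this.fderiv_eq]


/-- `(φ, ψ)` is the gradient of a solution of the translator equation on `Ω` in a direction whose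
vertical and horizontal components have ratio `τ`. -/
structure IsTranslatorGradient (Ω : Set (ℝ × ℝ)) (φ ψ : ℝ × ℝ → ℝ) (τ γ : ℝ) : Prop where
  isOpen : IsOpen Ω
  smooth_fst : ContDiffOn ℝ ∞ φ Ω
  smooth_snd : ContDiffOn ℝ ∞ ψ Ω
  closed : ∀ p ∈ Ω, pds ψ p = pdt φ p
  pde : ∀ p ∈ Ω, (1 + ψ p ^ 2) * pds φ p - 2 * φ p * ψ p * pdt φ p + (1 + φ p ^ 2) * pdt ψ p
    = γ * (1 + φ p ^ 2 + ψ p ^ 2) * (ψ p - τ)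

/-- Squared norm of the difference of the graph gradient and `(c, τ)`, in the metric of the plane
with gradient `(c, τ)`. -/
def gradDist (φ ψ : ℝ × ℝ → ℝ) (τ c : ℝ) (p : ℝ × ℝ) : ℝ :=
  (φ p - c) ^ 2 + (ψ p - τ) ^ 2 + (-τ * (φ p - c) + c * (ψ p - τ)) ^ 2

namespace IsTranslatorGradient

variable {Ω : Set (ℝ × ℝ)} {φ ψ : ℝ × ℝ → ℝ} {τ γ : ℝ} {x : ℝ × ℝ}

theorem third_order (h : IsTranslatorGradient Ω φ ψ τ γ) (hx : x ∈ Ω) (v : ℝ × ℝ) :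
    (1 + ψ x ^ 2) * (v.1 * pds (pds φ) x + v.2 * pdt (pds φ) x)
      - 2 * φ x * ψ x * (v.1 * pdt (pds φ) x + v.2 * pdt (pdt φ) x)
      + (1 + φ x ^ 2) * (v.1 * pdt (pdt φ) x + v.2 * pdt (pdt ψ) x)
    = γ * (2 * φ x * (v.1 * pds φ x + v.2 * pdt φ x)
          + 2 * ψ x * (v.1 * pdt φ x + v.2 * pdt ψ x)) * (ψ x - τ)
      + γ * (1 + φ x ^ 2 + ψ x ^ 2) * (v.1 * pdt φ x + v.2 * pdt ψ x)
      - (2 * ψ x * (v.1 * pdt φ x + v.2 * pdt ψ x) * pds φ x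
        - 2 * ((v.1 * pds φ x + v.2 * pdt φ x) * ψ x + φ x * (v.1 * pdt φ x + v.2 * pdt ψ x))
          * pdt φ x
        + 2 * φ x * (v.1 * pds φ x + v.2 * pdt φ x) * pdt ψ x) := by
  have hx0 : x + (0 : ℝ) • v ∈ Ω := by simpa using hx
  have d1 := hasDerivAt_line h.isOpen h.smooth_fst v hx0
  have d2 := hasDerivAt_line h.isOpen h.smooth_snd v hx0
  have d3 := hasDerivAt_line h.isOpen (contDiffOn_pds h.isOpen h.smooth_fst) v hx0
  have d4 := hasDerivAt_line h.isOpen (contDiffOn_pdt h.isOpen h.smooth_fst) v hx0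
  have d5 := hasDerivAt_line h.isOpen (contDiffOn_pdt h.isOpen h.smooth_snd) v hx0
  have hl := ((((d2.pow 2).const_add 1).mul d3).sub (((d1.const_mul 2).mul d2).mul d4)).add
    (((d1.pow 2).const_add 1).mul d5)
  have hr := ((((d1.pow 2).const_add 1).add (d2.pow 2)).const_mul γ).mul (d2.sub_const τ)
  have heq := (hl.congr_of_eventuallyEq (f₁ := fun t : ℝ =>
      γ * (1 + φ (x + t • v) ^ 2 + ψ (x + t • v) ^ 2) * (ψ (x + t • v) - τ)) (by
    filter_upwards [eventually_line_mem h.isOpen hx v] with t ht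
    exact (h.pde _ ht).symm)).unique hr
  have c1 : pds (pdt φ) x = pdt (pds φ) x := pds_pdt_comm h.isOpen h.smooth_fst hx
  have c2 : pds (pdt ψ) x = pdt (pdt φ) x :=
    (pds_pdt_comm h.isOpen h.smooth_snd hx).trans (pdt_congr h.isOpen h.closed hx)
  simp only [Pi.add_apply, Pi.mul_apply, Pi.pow_apply, zero_smul, add_zero, c1, c2,
    h.closed x hx] at heq
  linear_combination heq

/-- Bound for the linearised operator applied to the first derivatives of the gradient. -/
theorem third_order_bound (h : IsTranslatorGradient Ω φ ψ τ γ) (hx : x ∈ Ω) {B : ℝ} (hB : 1 ≤ B)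
    (hτ : |τ| ≤ B) (hγ : |γ| ≤ B) (hφ : |φ x| ≤ B) (hψ : |ψ x| ≤ B)
    (h11 : |pds φ x| ≤ B) (h12 : |pdt φ x| ≤ B) (h22 : |pdt ψ x| ≤ B) {v : ℝ × ℝ}
    (hv : |v.1| + |v.2| ≤ 1) :
    |(1 + ψ x ^ 2) * (v.1 * pds (pds φ) x + v.2 * pdt (pds φ) x)
      - 2 * φ x * ψ x * (v.1 * pdt (pds φ) x + v.2 * pdt (pdt φ) x)
      + (1 + φ x ^ 2) * (v.1 * pdt (pdt φ) x + v.2 * pdt (pdt ψ) x)|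
    ≤ 20 * B ^ 3 * (|pds φ x| + |pdt φ x| + |pdt ψ x|) := by
  rw [h.third_order hx v]
  set η := |pds φ x| + |pdt φ x| + |pdt ψ x| with hη
  have hη0 : 0 ≤ η := by positivity
  have key : ∀ {a b : ℝ}, |a| ≤ η → |b| ≤ η → |v.1 * a + v.2 * b| ≤ η := by
    intro a b ha hb
    calc |v.1 * a + v.2 * b| ≤ |v.1| * |a| + |v.2| * |b| := by
          rw [← abs_mul, ← abs_mul]; exact abs_add_le _ _
      _ ≤ |v.1| * η + |v.2| * η := by gcongr
      _ = (|v.1| + |v.2|) * η := by ring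
      _ ≤ 1 * η := by gcongr
      _ = η := one_mul _
  have hA := key (a := pds φ x) (b := pdt φ x)
    (by rw [hη]; linarith [abs_nonneg (pdt φ x), abs_nonneg (pdt ψ x)])
    (by rw [hη]; linarith [abs_nonneg (pds φ x), abs_nonneg (pdt ψ x)])
  have hC := key (a := pdt φ x) (b := pdt ψ x)
    (by rw [hη]; linarith [abs_nonneg (pds φ x), abs_nonneg (pdt ψ x)])
    (by rw [hη]; linarith [abs_nonneg (pds φ x), abs_nonneg (pdt φ x)])
  generalize v.1 * pds φ x + v.2 * pdt φ x = a at hA ⊢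
  generalize v.1 * pdt φ x + v.2 * pdt ψ x = b at hC ⊢
  generalize φ x = p at *
  generalize ψ x = q at *
  have hB0 : 0 ≤ B := by linarith
  have hB2 : B ^ 2 ≤ B ^ 3 := pow_le_pow_right₀ hB (by norm_num)
  have hB1 : B ≤ B ^ 3 := le_self_pow₀ hB (by norm_num)
  have hqτ : |q - τ| ≤ 2 * B := (abs_sub _ _).trans (by linarith)
  have f1 : |γ * (2 * p * a + 2 * q * b) * (q - τ)| ≤ 8 * B ^ 3 * η := by
    have : |2 * p * a + 2 * q * b| ≤ 4 * B * η := by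
      have h1 : |2 * p * a| ≤ 2 * B * η := by rw [abs_mul, abs_mul, abs_two]; gcongr
      have h2 : |2 * q * b| ≤ 2 * B * η := by rw [abs_mul, abs_mul, abs_two]; gcongr
      exact (abs_add_le _ _).trans (by linarith)
    rw [abs_mul, abs_mul]
    calc _ ≤ B * (4 * B * η) * (2 * B) := by gcongr
      _ = _ := by ring
  have f2 : |γ * (1 + p ^ 2 + q ^ 2) * b| ≤ 3 * B ^ 3 * η := by
    have : |1 + p ^ 2 + q ^ 2| ≤ 3 * B ^ 2 := by
      have h1 : p ^ 2 ≤ B ^ 2 := sq_le_sq' (by linarith [abs_le.1 hφ]) (abs_le.1 hφ).2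
      have h2 : q ^ 2 ≤ B ^ 2 := sq_le_sq' (by linarith [abs_le.1 hψ]) (abs_le.1 hψ).2
      rw [abs_of_nonneg (by positivity)]
      linarith [one_le_pow₀ hB (n := 2)]
    rw [abs_mul, abs_mul]
    calc _ ≤ B * (3 * B ^ 2) * η := by gcongr
      _ = _ := by ring
  have f3 : ∀ {r s w : ℝ}, |r| ≤ B → |s| ≤ η → |w| ≤ B → |2 * (r * s * w)| ≤ 2 * B ^ 2 * η := by
    intro r s w h1 h2 h3
    rw [abs_mul, abs_mul, abs_mul, abs_two]
    calc _ ≤ 2 * (B * η * B) := by gcongr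
      _ = _ := by ring
  have g1 := f3 hψ hC h11
  have g2 := f3 hψ hA h12
  have g3 := f3 hφ hC h12
  have g4 := f3 hφ hA h22
  have hBη : 2 * B ^ 2 * η ≤ 2 * B ^ 3 * η := by gcongr
  have hη3 : 0 ≤ B ^ 3 * η := by positivity
  rw [abs_le] at *
  constructor <;> linarith [f1.1, f1.2, f2.1, f2.2, g1.1, g1.2, g2.1, g2.2, g3.1, g3.2, g4.1, g4.2]

theorem hasTwoJet_snd (h : IsTranslatorGradient Ω φ ψ τ γ) (hx : x ∈ Ω) (v : ℝ × ℝ) :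
    HasTwoJet (fun t : ℝ => ψ (x + t • v)) (v.1 * pdt φ x + v.2 * pdt ψ x)
      (v.1 ^ 2 * pdt (pds φ) x + 2 * v.1 * v.2 * pdt (pdt φ) x + v.2 ^ 2 * pdt (pdt ψ) x) := by
  refine (hasTwoJet_line h.isOpen h.smooth_snd hx v).congr_jet ?_ ?_
  · rw [h.closed x hx]
  · rw [pds_congr h.isOpen h.closed hx, pds_pdt_comm h.isOpen h.smooth_fst hx,
      pdt_congr h.isOpen h.closed hx]

theorem hasTwoJet_gradDist (h : IsTranslatorGradient Ω φ ψ τ γ) (hx : x ∈ Ω) (c : ℝ) (v : ℝ × ℝ)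
    {l n₁ n₂ : ℝ} (hl : l = -τ * (φ x - c) + c * (ψ x - τ))
    (hn₁ : n₁ = φ x - c - τ * l) (hn₂ : n₂ = ψ x - τ + c * l)
    {a₁ a₂ b₁ b₂ : ℝ} (ha₁ : a₁ = v.1 * pds φ x + v.2 * pdt φ x)
    (ha₂ : a₂ = v.1 * pdt φ x + v.2 * pdt ψ x)
    (hb₁ : b₁ = v.1 ^ 2 * pds (pds φ) x + 2 * v.1 * v.2 * pdt (pds φ) x
      + v.2 ^ 2 * pdt (pdt φ) x)
    (hb₂ : b₂ = v.1 ^ 2 * pdt (pds φ) x + 2 * v.1 * v.2 * pdt (pdt φ) x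
      + v.2 ^ 2 * pdt (pdt ψ) x) :
    HasTwoJet (fun t : ℝ => gradDist φ ψ τ c (x + t • v)) (2 * (n₁ * a₁ + n₂ * a₂))
      (2 * (a₁ ^ 2 + a₂ ^ 2 + (-τ * a₁ + c * a₂) ^ 2) + 2 * (n₁ * b₁ + n₂ * b₂)) := by
  have j1 := (hasTwoJet_line h.isOpen h.smooth_fst hx v).add (HasTwoJet.const (-c))
  have j2 := (h.hasTwoJet_snd hx v).add (HasTwoJet.const (-τ))
  rw [← ha₁, ← hb₁] at j1
  rw [← ha₂, ← hb₂] at j2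
  have j3 := (j1.const_mul (-τ)).add (j2.const_mul c)
  have j := ((j1.mul j1).add (j2.mul j2)).add (j3.mul j3)
  simp only [zero_smul, add_zero] at j
  have hfun : (fun t : ℝ => gradDist φ ψ τ c (x + t • v)) = fun t : ℝ =>
      (φ (x + t • v) + -c) * (φ (x + t • v) + -c) + (ψ (x + t • v) + -τ) * (ψ (x + t • v) + -τ)
      + (-τ * (φ (x + t • v) + -c) + c * (ψ (x + t • v) + -τ))
        * (-τ * (φ (x + t • v) + -c) + c * (ψ (x + t • v) + -τ)) := by
    funext t; rw [gradDist]; ring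
  rw [hfun]
  refine j.congr_jet ?_ ?_
  · rw [hn₁, hn₂, hl]; ring
  · rw [hn₁, hn₂, hl]; ring

/-- The frame `(1, 0)`, `(0, 1)`, `(-ψ, φ)` represents the principal part of the translator
equation as a sum of squares. Along it, the second derivatives of `log (gradDist φ ψ τ c)` are
controlled by the first derivatives, uniformly in `c`. -/
theorem log_gradDist_estimate (h : IsTranslatorGradient Ω φ ψ τ γ) (hx : x ∈ Ω) {B : ℝ}
    (hB : 1 ≤ B) (hτ : |τ| ≤ B) (hγ : |γ| ≤ B) (hφ : |φ x| ≤ B) (hψ : |ψ x| ≤ B)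
    (h11 : |pds φ x| ≤ B) (h12 : |pdt φ x| ≤ B) (h22 : |pdt ψ x| ≤ B)
    {c : ℝ} (hc : |c| ≤ B) (hS : 0 < gradDist φ ψ τ c x) :
    ∃ (X₁ X₂ : ℝ) (b : ℝ × ℝ → ℝ),
      (∀ v : ℝ × ℝ, HasTwoJet (fun t : ℝ => Real.log (gradDist φ ψ τ c (x + t • v)))
        (v.1 * X₁ + v.2 * X₂) (b v)) ∧
      |b (1, 0) + b (0, 1) + b (-ψ x, φ x)| ≤
        12000 * (20 * B ^ 3) ^ 7 * (|X₁| + |X₂| + 1) := by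
  set P := 20 * B ^ 3 with hP
  have hB0 : 0 ≤ B := by linarith
  have hB3 : 1 ≤ B ^ 3 := one_le_pow₀ hB
  have hBP : B ≤ P := by rw [hP]; linarith [le_self_pow₀ hB (show 3 ≠ 0 by norm_num)]
  obtain ⟨l, hl⟩ : ∃ l, l = -τ * (φ x - c) + c * (ψ x - τ) := ⟨_, rfl⟩
  obtain ⟨n₁, hn₁⟩ : ∃ n, n = φ x - c - τ * l := ⟨_, rfl⟩
  obtain ⟨n₂, hn₂⟩ : ∃ n, n = ψ x - τ + c * l := ⟨_, rfl⟩
  have e1 := h.third_order_bound hx hB hτ hγ hφ hψ h11 h12 h22 (v := (1, 0)) (by simp)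
  have e2 := h.third_order_bound hx hB hτ hγ hφ hψ h11 h12 h22 (v := (0, 1)) (by simp)
  simp only [one_mul, zero_mul, add_zero, zero_add] at e1 e2
  have jS := fun v => (h.hasTwoJet_gradDist hx c v hl hn₁ hn₂ rfl rfl rfl rfl).log
    (by simpa using hS.ne')
  simp only [zero_smul, add_zero] at jS
  have hSd : gradDist φ ψ τ c x = (φ x - c) ^ 2 + (ψ x - τ) ^ 2 + l ^ 2 := by rw [gradDist, hl]
  have hpde := h.pde x hx
  generalize gradDist φ ψ τ c x = S at *
  have hfg : |γ * (1 + φ x ^ 2 + ψ x ^ 2) * (ψ x - τ)| ≤ P * (|φ x - c| + |ψ x - τ|) := by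
    have h1 : φ x ^ 2 ≤ B ^ 2 := sq_le_sq' (by linarith [abs_le.1 hφ]) (abs_le.1 hφ).2
    have h2 : ψ x ^ 2 ≤ B ^ 2 := sq_le_sq' (by linarith [abs_le.1 hψ]) (abs_le.1 hψ).2
    have h3 : |1 + φ x ^ 2 + ψ x ^ 2| ≤ 3 * B ^ 2 := by
      rw [abs_of_nonneg (by positivity)]
      linarith [one_le_pow₀ hB (n := 2)]
    rw [abs_mul, abs_mul]
    calc _ ≤ B * (3 * B ^ 2) * |ψ x - τ| := by gcongr
      _ = 3 * B ^ 3 * (0 + |ψ x - τ|) := by ring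
      _ ≤ P * (|φ x - c| + |ψ x - τ|) := by rw [hP]; gcongr; norm_num; positivity
  refine ⟨2 * (n₁ * pds φ x + n₂ * pdt φ x) / S, 2 * (n₁ * pdt φ x + n₂ * pdt ψ x) / S, _,
    fun v => (jS v).congr_jet (by ring) rfl, ?_⟩
  have hφc : c + (φ x - c) = φ x := by ring
  have hψτ : τ + (ψ x - τ) = ψ x := by ring
  have est := log_gradient_operator_bound (P := P) (c1 := c) (c2 := τ) (g1 := φ x - c)
    (g2 := ψ x - τ) (w11 := pds φ x) (w12 := pdt φ x) (w22 := pdt ψ x)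
    (X1 := 2 * (n₁ * pds φ x + n₂ * pdt φ x) / S) (X2 := 2 * (n₁ * pdt φ x + n₂ * pdt ψ x) / S)
    (by linarith) (by linarith) (by linarith) (by rw [hφc]; linarith) (by rw [hψτ]; linarith)
    (by linarith) (by linarith) rfl (by rw [hφc, hψτ, hpde]; exact hfg) e1 e2 hl hSd hn₁ hn₂ hS
    (by field_simp) (by field_simp)
  refine le_of_eq_of_le (congrArg _ ?_) est
  have id := quadratic_conformal_identity c τ (φ x - c) (ψ x - τ) (pds φ x) (pdt φ x) (pdt ψ x)
  simp only at id
  rw [← hl, ← hSd, ← hn₁, ← hn₂] at id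
  rw [← id]
  rw [hφc, hψτ]
  field_simp
  ring

end IsTranslatorGradient


/-- Squared length of `z` in the metric induced on the plane with gradient `(σ, τ)`. -/
def quadDist (σ τ : ℝ) (z : ℝ × ℝ) : ℝ := z.1 ^ 2 + z.2 ^ 2 + (σ * z.1 + τ * z.2) ^ 2

theorem quadDist_nonneg (σ τ : ℝ) (z : ℝ × ℝ) : 0 ≤ quadDist σ τ z := by
  rw [quadDist]; positivity

theorem norm_le_sqrt_quadDist (σ τ : ℝ) (z : ℝ × ℝ) : ‖z‖ ≤ √(quadDist σ τ z) := by
  rw [Prod.norm_def, max_le_iff, Real.norm_eq_abs, Real.norm_eq_abs, quadDist]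
  constructor
  · exact Real.abs_le_sqrt (by linarith [sq_nonneg z.2, sq_nonneg (σ * z.1 + τ * z.2)])
  · exact Real.abs_le_sqrt (by linarith [sq_nonneg z.1, sq_nonneg (σ * z.1 + τ * z.2)])

theorem sqrt_quadDist_le {σ τ B : ℝ} (hB : 1 ≤ B) (hσ : |σ| ≤ B) (hτ : |τ| ≤ B) (z : ℝ × ℝ) :
    √(quadDist σ τ z) ≤ 3 * B * ‖z‖ := by
  have h1 : |z.1| ≤ ‖z‖ := norm_fst_le z
  have h2 : |z.2| ≤ ‖z‖ := norm_snd_le z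
  have h3 : |σ * z.1 + τ * z.2| ≤ 2 * B * ‖z‖ := by
    calc |σ * z.1 + τ * z.2| ≤ |σ| * |z.1| + |τ| * |z.2| := by
          rw [← abs_mul, ← abs_mul]; exact abs_add_le _ _
      _ ≤ B * ‖z‖ + B * ‖z‖ := by gcongr
      _ = _ := by ring
  have hB0 : 0 ≤ B := by linarith
  rw [Real.sqrt_le_left (by positivity), quadDist]
  have k1 : z.1 ^ 2 ≤ ‖z‖ ^ 2 := sq_le_sq.2 (by rwa [abs_of_nonneg (norm_nonneg z)])
  have k2 : z.2 ^ 2 ≤ ‖z‖ ^ 2 := sq_le_sq.2 (by rwa [abs_of_nonneg (norm_nonneg z)])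
  have k3 : (σ * z.1 + τ * z.2) ^ 2 ≤ (2 * B * ‖z‖) ^ 2 :=
    sq_le_sq.2 (by rwa [abs_of_nonneg (by positivity : 0 ≤ 2 * B * ‖z‖)])
  have k4 : 1 * ‖z‖ ^ 2 ≤ B ^ 2 * ‖z‖ ^ 2 := by
    gcongr; exact one_le_pow₀ hB
  linarith [k1, k2, k3, mul_nonneg (sq_nonneg B) (sq_nonneg ‖z‖)]

theorem sqrt_quadDist_pos {σ τ : ℝ} {z : ℝ × ℝ} (hz : z ≠ 0) : 0 < √(quadDist σ τ z) :=
  (norm_pos_iff.2 hz).trans_le (norm_le_sqrt_quadDist σ τ z)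

theorem continuous_quadDist (σ τ : ℝ) : Continuous (quadDist σ τ) := by
  unfold quadDist; fun_prop

theorem hasTwoJet_quadDist (σ τ : ℝ) (z v : ℝ × ℝ) :
    HasTwoJet (fun t : ℝ => quadDist σ τ (z + t • v))
      (v.1 * (2 * (z.1 + σ * (σ * z.1 + τ * z.2))) + v.2 * (2 * (z.2 + τ * (σ * z.1 + τ * z.2))))
      (2 * (v.1 ^ 2 + v.2 ^ 2 + (σ * v.1 + τ * v.2) ^ 2)) := by
  have j1 := HasTwoJet.affine z.1 v.1
  have j2 := HasTwoJet.affine z.2 v.2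
  have j3 := (j1.const_mul σ).add (j2.const_mul τ)
  have j := ((j1.mul j1).add (j2.mul j2)).add (j3.mul j3)
  have hfun : (fun t : ℝ => quadDist σ τ (z + t • v)) = fun t : ℝ =>
      (z.1 + t * v.1) * (z.1 + t * v.1) + (z.2 + t * v.2) * (z.2 + t * v.2)
      + (σ * (z.1 + t * v.1) + τ * (z.2 + t * v.2))
        * (σ * (z.1 + t * v.1) + τ * (z.2 + t * v.2)) := by
    funext t
    simp only [quadDist, Prod.fst_add, Prod.snd_add, Prod.smul_fst, Prod.smul_snd, smul_eq_mul]
    ring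
  rw [hfun]
  refine j.congr_jet ?_ ?_ <;> ring

/-- The logarithmic barrier `-log r + κ r` around the origin. -/
def logBarrier (σ τ κ : ℝ) (z : ℝ × ℝ) : ℝ :=
  -(1 / 2) * Real.log (quadDist σ τ z) + κ * √(quadDist σ τ z)

theorem logBarrier_estimate {P κ σ τ p q : ℝ} {z : ℝ × ℝ} (hP : 1 ≤ P) (hκ : 0 ≤ κ)
    (hσ : |σ| ≤ P) (hτ : |τ| ≤ P) (hz : z ≠ 0) {r : ℝ} (hr : r = √(quadDist σ τ z)) (hr1 : r ≤ 1)
    (hp : |p - σ| ≤ P * r) (hq : |q - τ| ≤ P * r) :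
    ∃ (X₁ X₂ : ℝ) (b : ℝ × ℝ → ℝ),
      (∀ v : ℝ × ℝ, HasTwoJet (fun t : ℝ => logBarrier σ τ κ (z + t • v))
        (v.1 * X₁ + v.2 * X₂) (b v)) ∧
      κ / r - 74 * P ^ 4 * (1 / r + κ) ≤ b (1, 0) + b (0, 1) + b (-q, p) ∧
      |X₁| ≤ 74 * P ^ 4 * (1 / r + κ) ∧ |X₂| ≤ 74 * P ^ 4 * (1 / r + κ) := by
  have hr0 : 0 < r := hr ▸ sqrt_quadDist_pos hz
  have hq2 : quadDist σ τ z = r ^ 2 := by rw [hr, Real.sq_sqrt (quadDist_nonneg σ τ z)]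
  obtain ⟨h1, h2, h3⟩ := logarithmic_barrier_bound (κ := κ) hP hκ hσ hτ hr0 hr1 hp hq
    (z1 := z.1) (z2 := z.2) (by rw [← hq2, quadDist]) rfl rfl rfl rfl
  refine ⟨_, _, _, fun v => ((hasTwoJet_quadDist σ τ z v).log_barrier κ hr0
    (by rwa [zero_smul, add_zero])).congr_jet ?_ rfl, ?_, h2, h3⟩
  · ring
  · refine h1.trans_eq ?_
    rw [add_sub_cancel, add_sub_cancel]
    ring

theorem isLocalMax_line {h : ℝ × ℝ → ℝ} {x : ℝ × ℝ} (hm : IsLocalMax h x) (v : ℝ × ℝ) :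
    IsLocalMax (fun t : ℝ => h (x + t • v)) 0 := by
  have hc : ContinuousAt (fun t : ℝ => x + t • v) 0 := by fun_prop
  have : IsLocalMax h (x + (0 : ℝ) • v) := by simpa using hm
  exact IsLocalMax.comp_continuous this hc

namespace IsTranslatorGradient

variable {Ω : Set (ℝ × ℝ)} {φ ψ : ℝ × ℝ → ℝ} {τ γ : ℝ} {x : ℝ × ℝ}

theorem exists_bound (h : IsTranslatorGradient Ω φ ψ τ γ) {Z : Set (ℝ × ℝ)} (hZ : IsCompact Z)
    (hZΩ : Z ⊆ Ω) (M : ℝ) : ∃ B : ℝ, 1 ≤ B ∧ M ≤ B ∧ |τ| ≤ B ∧ |γ| ≤ B ∧ ∀ x ∈ Z,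
      |φ x| ≤ B ∧ |ψ x| ≤ B ∧ |pds φ x| ≤ B ∧ |pdt φ x| ≤ B ∧ |pdt ψ x| ≤ B := by
  have key : ∀ {f : ℝ × ℝ → ℝ}, ContDiffOn ℝ ∞ f Ω → ∃ C, ∀ x ∈ Z, |f x| ≤ C := fun hf =>
    hZ.exists_bound_of_continuousOn (hf.continuousOn.mono hZΩ)
  obtain ⟨C1, h1⟩ := key h.smooth_fst
  obtain ⟨C2, h2⟩ := key h.smooth_snd
  obtain ⟨C3, h3⟩ := key (contDiffOn_pds h.isOpen h.smooth_fst)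
  obtain ⟨C4, h4⟩ := key (contDiffOn_pdt h.isOpen h.smooth_fst)
  obtain ⟨C5, h5⟩ := key (contDiffOn_pdt h.isOpen h.smooth_snd)
  refine ⟨1 + |M| + |τ| + |γ| + |C1| + |C2| + |C3| + |C4| + |C5|, ?_⟩
  have := le_abs_self M
  have := le_abs_self C1
  have := le_abs_self C2
  have := le_abs_self C3
  have := le_abs_self C4
  have := le_abs_self C5
  have := abs_nonneg M
  have := abs_nonneg τ
  have := abs_nonneg γ
  have := abs_nonneg C1
  have := abs_nonneg C2
  have := abs_nonneg C3
  have := abs_nonneg C4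
  have := abs_nonneg C5
  refine ⟨by linarith, by linarith, by linarith, by linarith, fun x hx => ?_⟩
  refine ⟨(h1 x hx).trans ?_, (h2 x hx).trans ?_, (h3 x hx).trans ?_, (h4 x hx).trans ?_,
    (h5 x hx).trans ?_⟩ <;> linarith

theorem not_isLocalMax_log_add_barrier (h : IsTranslatorGradient Ω φ ψ τ γ) (hx : x ∈ Ω) {B : ℝ}
    (hB : 1 ≤ B) (hτ : |τ| ≤ B) (hγ : |γ| ≤ B) (hφ : |φ x| ≤ B) (hψ : |ψ x| ≤ B)
    (h11 : |pds φ x| ≤ B) (h12 : |pdt φ x| ≤ B) (h22 : |pdt ψ x| ≤ B)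
    {σ : ℝ} (hσ : |σ| ≤ B) (hS : 0 < gradDist φ ψ τ σ x)
    {P C K κ : ℝ} (hBP : B ≤ P) (hC : C = 12000 * (20 * B ^ 3) ^ 7)
    (hK : K = 74 * P ^ 4 * (1 + 2 * C)) (hκ : κ = K + 1)
    {t : Finset (ℝ × ℝ)} (ht : t.Nonempty) (htx : x ∉ t)
    (hr : ∀ y ∈ t, √(quadDist σ τ (x - y)) * (K * κ + C + 1) ≤ 1)
    (hg₁ : ∀ y ∈ t, |φ x - σ| ≤ P * √(quadDist σ τ (x - y)))
    (hg₂ : ∀ y ∈ t, |ψ x - τ| ≤ P * √(quadDist σ τ (x - y))) :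
    ¬ IsLocalMax (fun x => Real.log (gradDist φ ψ τ σ x) + ∑ y ∈ t, logBarrier σ τ κ (x - y)) x := by
  intro hm
  have hP : 1 ≤ P := hB.trans hBP
  have hB0 : 0 ≤ B := by linarith
  have hP0 : 0 ≤ P := by linarith
  have hC0 : 0 ≤ C := by rw [hC]; positivity
  have hK0 : 0 ≤ K := by rw [hK]; positivity
  have hκ0 : 0 ≤ κ := by linarith
  have hKκ : 0 ≤ K * κ := by positivity
  have hxy : ∀ y ∈ t, x - y ≠ 0 := fun y hy e => htx (by rwa [sub_eq_zero.1 e])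
  obtain ⟨X₁, X₂, b, hj, hb⟩ := h.log_gradDist_estimate hx hB hτ hγ hφ hψ h11 h12 h22 hσ hS
  rw [← hC] at hb
  have hr1 : ∀ y ∈ t, √(quadDist σ τ (x - y)) ≤ 1 := fun y hy => by
    have := hr y hy
    have h0 := Real.sqrt_nonneg (quadDist σ τ (x - y))
    nlinarith [mul_nonneg h0 (add_nonneg hKκ hC0)]
  have hbar : ∀ y : ℝ × ℝ, ∃ (Y₁ Y₂ : ℝ) (d : ℝ × ℝ → ℝ), y ∈ t →
      (∀ v : ℝ × ℝ, HasTwoJet (fun s : ℝ => logBarrier σ τ κ (x - y + s • v))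
        (v.1 * Y₁ + v.2 * Y₂) (d v)) ∧
      κ / √(quadDist σ τ (x - y)) - 74 * P ^ 4 * (1 / √(quadDist σ τ (x - y)) + κ)
        ≤ d (1, 0) + d (0, 1) + d (-ψ x, φ x) ∧
      |Y₁| ≤ 74 * P ^ 4 * (1 / √(quadDist σ τ (x - y)) + κ) ∧
      |Y₂| ≤ 74 * P ^ 4 * (1 / √(quadDist σ τ (x - y)) + κ) := by
    intro y
    by_cases hy : y ∈ t
    · obtain ⟨Y₁, Y₂, d, hd⟩ := logBarrier_estimate (κ := κ) hP hκ0 (hσ.trans hBP) (hτ.trans hBP)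
        (hxy y hy) rfl (hr1 y hy) (hg₁ y hy) (hg₂ y hy)
      exact ⟨Y₁, Y₂, d, fun _ => hd⟩
    · exact ⟨0, 0, 0, fun h => absurd h hy⟩
  choose Y₁ Y₂ d hd using hbar
  have hjet : ∀ v : ℝ × ℝ, v.1 * X₁ + v.2 * X₂ + ∑ y ∈ t, (v.1 * Y₁ y + v.2 * Y₂ y) = 0 ∧
      b v + ∑ y ∈ t, d y v ≤ 0 := by
    intro v
    refine HasTwoJet.of_isLocalMax ((hj v).add (HasTwoJet.sum fun y hy => (hd y hy).1 v)) ?_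
    have := isLocalMax_line hm v
    simpa only [add_sub_right_comm] using this
  set A : ℝ × ℝ → ℝ := fun y => 74 * P ^ 4 * (1 / √(quadDist σ τ (x - y)) + κ) with hA
  have hsum : ∀ {X : ℝ} {Y : ℝ × ℝ → ℝ}, X + ∑ y ∈ t, Y y = 0 → (∀ y ∈ t, |Y y| ≤ A y) →
      |X| ≤ ∑ y ∈ t, A y := by
    intro X Y h1 h2
    rw [eq_neg_of_add_eq_zero_left h1, abs_neg]
    exact (Finset.abs_sum_le_sum_abs _ _).trans (Finset.sum_le_sum h2)
  have hX₁ := hsum (by simpa using (hjet (1, 0)).1) fun y hy => (hd y hy).2.2.1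
  have hX₂ := hsum (by simpa using (hjet (0, 1)).1) fun y hy => (hd y hy).2.2.2
  have hMb : b (1, 0) + b (0, 1) + b (-ψ x, φ x)
      + ∑ y ∈ t, (d y (1, 0) + d y (0, 1) + d y (-ψ x, φ x)) ≤ 0 := by
    rw [Finset.sum_add_distrib, Finset.sum_add_distrib]
    linarith [(hjet (1, 0)).2, (hjet (0, 1)).2, (hjet (-ψ x, φ x)).2]
  have hterm : ∀ y ∈ t, C < κ / √(quadDist σ τ (x - y)) - (1 + 2 * C) * A y := by
    intro y hy
    have h0 : 0 < √(quadDist σ τ (x - y)) := sqrt_quadDist_pos (hxy y hy)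
    have h1 : κ / √(quadDist σ τ (x - y)) - (1 + 2 * C) * A y
        = 1 / √(quadDist σ τ (x - y)) - K * κ := by
      have : (1 + 2 * C) * A y = K * (1 / √(quadDist σ τ (x - y)) + κ) := by rw [hA, hK]; ring
      rw [this, hκ]; ring
    have h2 : K * κ + C + 1 ≤ 1 / √(quadDist σ τ (x - y)) := by
      rw [le_div_iff₀ h0, mul_comm]; exact hr y hy
    linarith
  have hlow : ∑ y ∈ t, (κ / √(quadDist σ τ (x - y)) - A y)
      ≤ ∑ y ∈ t, (d y (1, 0) + d y (0, 1) + d y (-ψ x, φ x)) :=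
    Finset.sum_le_sum fun y hy => (hd y hy).2.1
  obtain ⟨y₀, hy₀⟩ := ht
  have hone : C < ∑ y ∈ t, (κ / √(quadDist σ τ (x - y)) - (1 + 2 * C) * A y) :=
    (hterm y₀ hy₀).trans_le (Finset.single_le_sum
      (f := fun y => κ / √(quadDist σ τ (x - y)) - (1 + 2 * C) * A y)
      (fun y hy => hC0.trans (hterm y hy).le) hy₀)
  rw [Finset.sum_sub_distrib, ← Finset.mul_sum] at hone
  rw [Finset.sum_sub_distrib] at hlow
  have hCX : C * (|X₁| + |X₂| + 1) ≤ C * (∑ y ∈ t, A y + ∑ y ∈ t, A y + 1) := by gcongr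
  linarith [(abs_le.1 hb).1]

end IsTranslatorGradient


theorem abs_sub_le_of_partials_le {Ω : Set (ℝ × ℝ)} {f : ℝ × ℝ → ℝ} (hΩ : IsOpen Ω)
    (hf : ContDiffOn ℝ ∞ f Ω) {x₀ x y : ℝ × ℝ} {R B : ℝ} (hR : closedBall x₀ R ⊆ Ω)
    (h1 : ∀ z ∈ closedBall x₀ R, |pds f z| ≤ B) (h2 : ∀ z ∈ closedBall x₀ R, |pdt f z| ≤ B)
    (hx : x ∈ closedBall x₀ R) (hy : y ∈ closedBall x₀ R) : |f x - f y| ≤ 2 * B * ‖x - y‖ := by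
  refine (convex_closedBall x₀ R).norm_image_sub_le_of_norm_fderiv_le (𝕜 := ℝ)
    (fun z hz => (hf.contDiffAt (hΩ.mem_nhds (hR hz))).differentiableAt (by simp))
    (fun z hz => ?_) hy hx
  have hB : 0 ≤ B := (abs_nonneg _).trans (h1 z hz)
  refine ContinuousLinearMap.opNorm_le_bound _ (by positivity) fun v => ?_
  rw [fderiv_eq_partials, Real.norm_eq_abs]
  have k1 : |v.1| ≤ ‖v‖ := norm_fst_le v
  have k2 : |v.2| ≤ ‖v‖ := norm_snd_le v
  have k3 := h1 z hz
  have k4 := h2 z hz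
  calc |v.1 * pds f z + v.2 * pdt f z| ≤ |v.1| * |pds f z| + |v.2| * |pdt f z| := by
        rw [← abs_mul, ← abs_mul]; exact abs_add_le _ _
    _ ≤ ‖v‖ * B + ‖v‖ * B := by gcongr
    _ = _ := by ring

theorem gradDist_nonneg (φ ψ : ℝ × ℝ → ℝ) (τ c : ℝ) (p : ℝ × ℝ) : 0 ≤ gradDist φ ψ τ c p := by
  rw [gradDist]; positivity

theorem gradDist_eq_zero_iff {φ ψ : ℝ × ℝ → ℝ} {τ c : ℝ} {p : ℝ × ℝ} :
    gradDist φ ψ τ c p = 0 ↔ φ p = c ∧ ψ p = τ := by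
  rw [gradDist]
  constructor
  · intro h
    have h1 := sq_nonneg (φ p - c)
    have h2 := sq_nonneg (ψ p - τ)
    have h3 := sq_nonneg (-τ * (φ p - c) + c * (ψ p - τ))
    exact ⟨sub_eq_zero.1 (pow_eq_zero_iff two_ne_zero |>.1 (by linarith)),
      sub_eq_zero.1 (pow_eq_zero_iff two_ne_zero |>.1 (by linarith))⟩
  · rintro ⟨rfl, rfl⟩; simp

theorem gradDist_le {φ ψ : ℝ × ℝ → ℝ} {τ c P r : ℝ} {p : ℝ × ℝ} (hP : 1 ≤ P) (hτ : |τ| ≤ P)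
    (hc : |c| ≤ P) (h1 : |φ p - c| ≤ P * r) (h2 : |ψ p - τ| ≤ P * r) :
    gradDist φ ψ τ c p ≤ 6 * P ^ 4 * r ^ 2 := by
  have hP0 : 0 ≤ P := by linarith
  have hPr : 0 ≤ P * r := (abs_nonneg _).trans h1
  have h3 : |-τ * (φ p - c) + c * (ψ p - τ)| ≤ P * (P * r) + P * (P * r) := by
    refine (abs_add_le _ _).trans ?_
    rw [abs_mul, abs_mul, abs_neg]
    gcongr
  have k1 := sq_le_sq.2 (h1.trans (le_abs_self _))
  have k2 := sq_le_sq.2 (h2.trans (le_abs_self _))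
  have k3 := sq_le_sq.2 (h3.trans (le_abs_self _))
  have k4 : P ^ 2 * r ^ 2 ≤ P ^ 4 * r ^ 2 := by
    gcongr
    norm_num
  rw [gradDist]
  linarith

/-- Exponential of `logBarrier`, with value `0` at the pole. -/
def poleWeight (σ τ κ : ℝ) (z : ℝ × ℝ) : ℝ :=
  Real.exp (κ * √(quadDist σ τ z)) / √(quadDist σ τ z)

theorem poleWeight_zero (σ τ κ : ℝ) : poleWeight σ τ κ 0 = 0 := by
  simp [poleWeight, quadDist]

theorem poleWeight_pos {σ τ κ : ℝ} {z : ℝ × ℝ} (hz : z ≠ 0) : 0 < poleWeight σ τ κ z :=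
  div_pos (Real.exp_pos _) (sqrt_quadDist_pos hz)

theorem log_poleWeight {σ τ κ : ℝ} {z : ℝ × ℝ} (hz : z ≠ 0) :
    Real.log (poleWeight σ τ κ z) = logBarrier σ τ κ z := by
  rw [poleWeight, Real.log_div (Real.exp_pos _).ne' (sqrt_quadDist_pos hz).ne', Real.log_exp,
    Real.log_sqrt (quadDist_nonneg σ τ z), logBarrier]
  ring

theorem continuousAt_poleWeight {σ τ κ : ℝ} {z : ℝ × ℝ} (hz : z ≠ 0) :
    ContinuousAt (poleWeight σ τ κ) z := by
  have hc : Continuous fun z : ℝ × ℝ => √(quadDist σ τ z) := (continuous_quadDist σ τ).sqrt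
  exact ((Real.continuous_exp.comp (continuous_const.mul hc)).continuousAt).div hc.continuousAt
    (sqrt_quadDist_pos hz).ne'

namespace IsTranslatorGradient

variable {Ω : Set (ℝ × ℝ)} {φ ψ : ℝ × ℝ → ℝ} {τ γ : ℝ}

theorem continuousOn_gradDist (h : IsTranslatorGradient Ω φ ψ τ γ) (c : ℝ) :
    ContinuousOn (gradDist φ ψ τ c) Ω := by
  have h1 := h.smooth_fst.continuousOn
  have h2 := h.smooth_snd.continuousOn
  unfold gradDist
  fun_prop

end IsTranslatorGradient

/-- A nonnegative function vanishing quadratically at the points of a finite set stays continuous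
after multiplication by simple poles at these points. -/
theorem continuousOn_mul_prod_poleWeight {S : ℝ × ℝ → ℝ} {Z : Set (ℝ × ℝ)} (hS : ContinuousOn S Z)
    {σ τ κ C : ℝ} {t : Finset (ℝ × ℝ)}
    (hC : ∀ y ∈ t, ∀ x ∈ Z, |S x| ≤ C * √(quadDist σ τ (x - y)) ^ 2) :
    ContinuousOn (fun x => S x * ∏ y ∈ t, poleWeight σ τ κ (x - y)) Z := by
  have hcont : ∀ {x y : ℝ × ℝ}, x ≠ y →
      ContinuousWithinAt (fun x => poleWeight σ τ κ (x - y)) Z x := fun {x y} hxy =>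
    (ContinuousAt.comp (f := fun x => x - y) (continuousAt_poleWeight (sub_ne_zero.2 hxy))
      (by fun_prop)).continuousWithinAt
  intro x hx
  by_cases hxt : x ∈ t
  · have hfun : (fun w => S w * ∏ y ∈ t, poleWeight σ τ κ (w - y)) = fun w =>
        S w * poleWeight σ τ κ (w - x) * ∏ y ∈ t.erase x, poleWeight σ τ κ (w - y) := by
      funext w
      rw [mul_assoc, Finset.mul_prod_erase t (fun y => poleWeight σ τ κ (w - y)) hxt]
    rw [hfun]
    refine ContinuousWithinAt.mul ?_ (tendsto_finsetProd _ fun y hy =>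
      hcont (Finset.ne_of_mem_erase hy).symm)
    rw [ContinuousWithinAt, sub_self, poleWeight_zero, mul_zero]
    have hlim : Tendsto (fun w => C * √(quadDist σ τ (w - x))
        * Real.exp (κ * √(quadDist σ τ (w - x)))) (𝓝[Z] x) (𝓝 0) := by
      have hc : Continuous fun w => √(quadDist σ τ (w - x)) :=
        ((continuous_quadDist σ τ).comp (continuous_sub_right x)).sqrt
      have : Continuous fun w => C * √(quadDist σ τ (w - x))
          * Real.exp (κ * √(quadDist σ τ (w - x))) := by fun_prop
      have h0 := (this.tendsto x).mono_left (nhdsWithin_le_nhds (s := Z))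
      simpa [quadDist] using h0
    refine squeeze_zero_norm' ?_ hlim
    filter_upwards [self_mem_nhdsWithin] with w hw
    have hb := hC x hxt w hw
    have hr0 := Real.sqrt_nonneg (quadDist σ τ (w - x))
    rw [Real.norm_eq_abs, abs_mul, poleWeight, abs_div, abs_of_pos (Real.exp_pos _),
      abs_of_nonneg hr0]
    rcases hr0.eq_or_lt with h0 | h0
    · simp [← h0]
    · calc |S w| * (Real.exp (κ * √(quadDist σ τ (w - x))) / √(quadDist σ τ (w - x)))
          ≤ C * √(quadDist σ τ (w - x)) ^ 2
            * (Real.exp (κ * √(quadDist σ τ (w - x))) / √(quadDist σ τ (w - x))) := by gcongr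
        _ = _ := by field_simp
  · exact (hS x hx).mul (tendsto_finsetProd _ fun y hy =>
      hcont fun e => hxt (e ▸ hy))

namespace IsTranslatorGradient

variable {Ω : Set (ℝ × ℝ)} {φ ψ : ℝ × ℝ → ℝ} {τ γ : ℝ}

/-- If `(σ, τ)` is attained on a set accumulating at a point of the domain, then it is attained on
a neighbourhood of this point. -/
theorem eventually_eq_of_accPt (h : IsTranslatorGradient Ω φ ψ τ γ) {x₀ : ℝ × ℝ} (hx₀ : x₀ ∈ Ω)
    {σ : ℝ} (hacc : AccPt x₀ (𝓟 {x | φ x = σ ∧ ψ x = τ})) :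
    ∀ᶠ x in 𝓝 x₀, φ x = σ ∧ ψ x = τ := by
  obtain ⟨R₀, hR₀, hR₀Ω⟩ := Metric.nhds_basis_closedBall.mem_iff.1 (h.isOpen.mem_nhds hx₀)
  obtain ⟨B, hB, hσ, hτ, hγ, hbd⟩ := h.exists_bound (isCompact_closedBall x₀ R₀) hR₀Ω |σ|
  obtain ⟨P, hP⟩ : ∃ P, P = 2 * B := ⟨_, rfl⟩
  obtain ⟨C, hC⟩ : ∃ C, C = 12000 * (20 * B ^ 3) ^ 7 := ⟨_, rfl⟩
  obtain ⟨K, hK⟩ : ∃ K, K = 74 * P ^ 4 * (1 + 2 * C) := ⟨_, rfl⟩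
  obtain ⟨κ, hκ⟩ : ∃ κ, κ = K + 1 := ⟨_, rfl⟩
  have hB0 : 0 < B := by linarith
  have hP1 : 1 ≤ P := by linarith
  have hC0 : 0 ≤ C := by rw [hC]; positivity
  have hK1 : 1 ≤ K := by
    have : 1 ≤ P ^ 4 := one_le_pow₀ hP1
    rw [hK]; nlinarith
  have hκ0 : 0 ≤ κ := by linarith
  have hKκ : κ ≤ K * κ := le_mul_of_one_le_left hκ0 hK1
  obtain ⟨R, hR⟩ : ∃ R, R = min R₀ (1 / (6 * B * (K * κ + C + 1))) := ⟨_, rfl⟩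
  have hden : 0 < K * κ + C + 1 := by linarith
  have hRpos : 0 < R := by rw [hR]; exact lt_min hR₀ (by positivity)
  have hRR₀ : closedBall x₀ R ⊆ closedBall x₀ R₀ :=
    closedBall_subset_closedBall (hR ▸ min_le_left _ _)
  have hRden : 3 * B * (2 * R) * (K * κ + C + 1) ≤ 1 := by
    have : R ≤ 1 / (6 * B * (K * κ + C + 1)) := hR ▸ min_le_right _ _
    rw [le_div_iff₀ (by positivity)] at this
    linarith
  obtain ⟨ρ, hρ⟩ : ∃ ρ, ρ = R * Real.exp (-2) / (12 * B) := ⟨_, rfl⟩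
  have hρ0 : 0 < ρ := by rw [hρ]; positivity
  have hexp : Real.exp (-2) ≤ 1 := Real.exp_le_one_iff.2 (by norm_num)
  have hρR : ρ ≤ R / 2 := by
    rw [hρ, div_le_div_iff₀ (by positivity) (by norm_num)]
    calc R * Real.exp (-2) * 2 ≤ R * 1 * 2 := by gcongr
      _ ≤ R * (12 * B) := by nlinarith
  have hρball : ball x₀ ρ ⊆ closedBall x₀ R :=
    ball_subset_closedBall.trans (closedBall_subset_closedBall (by linarith))
  have hrle : ∀ z : ℝ × ℝ, √(quadDist σ τ z) ≤ 3 * B * ‖z‖ := sqrt_quadDist_le hB hσ hτ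
  have hdist : ∀ x ∈ closedBall x₀ R, ∀ y ∈ ball x₀ ρ,
      √(quadDist σ τ (x - y)) * (K * κ + C + 1) ≤ 1 := by
    intro x hx y hy
    have : ‖x - y‖ ≤ 2 * R := by
      rw [← dist_eq_norm]
      have := dist_triangle_right x y x₀
      rw [mem_closedBall] at hx
      rw [mem_ball] at hy
      linarith
    calc _ ≤ 3 * B * ‖x - y‖ * (K * κ + C + 1) := by gcongr; exact hrle _
      _ ≤ 3 * B * (2 * R) * (K * κ + C + 1) := by gcongr
      _ ≤ 1 := hRden
  have hdistκ : ∀ x ∈ closedBall x₀ R, ∀ y ∈ ball x₀ ρ, κ * √(quadDist σ τ (x - y)) ≤ 1 := by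
    intro x hx y hy
    have h1 := hdist x hx y hy
    have h0 := Real.sqrt_nonneg (quadDist σ τ (x - y))
    have h2 : √(quadDist σ τ (x - y)) * κ ≤ √(quadDist σ τ (x - y)) * (K * κ + C + 1) := by
      gcongr; linarith
    linarith
  have hlip : ∀ {f : ℝ × ℝ → ℝ} {c : ℝ}, ContDiffOn ℝ ∞ f Ω →
      (∀ z ∈ closedBall x₀ R₀, |pds f z| ≤ B) → (∀ z ∈ closedBall x₀ R₀, |pdt f z| ≤ B) →
      ∀ x ∈ closedBall x₀ R, ∀ y ∈ ball x₀ ρ, f y = c →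
        |f x - c| ≤ P * √(quadDist σ τ (x - y)) := by
    intro f c hf h1 h2 x hx y hy hfy
    rw [← hfy, hP]
    refine (abs_sub_le_of_partials_le h.isOpen hf hR₀Ω h1 h2 (hRR₀ hx) (hRR₀ (hρball hy))).trans ?_
    gcongr
    exact norm_le_sqrt_quadDist _ _ _
  have hlip₁ := hlip (c := σ) h.smooth_fst (fun z hz => (hbd z hz).2.2.1)
    (fun z hz => (hbd z hz).2.2.2.1)
  have hlip₂ := hlip (c := τ) h.smooth_snd
    (fun z hz => by rw [h.closed z (hR₀Ω hz)]; exact (hbd z hz).2.2.2.1)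
    (fun z hz => (hbd z hz).2.2.2.2)
  have hgrad : ∀ x ∈ closedBall x₀ R, ∀ y ∈ ball x₀ ρ, φ y = σ → ψ y = τ →
      gradDist φ ψ τ σ x ≤ 6 * P ^ 4 * √(quadDist σ τ (x - y)) ^ 2 := fun x hx y hy h1 h2 =>
    gradDist_le hP1 (by linarith) (by linarith) (hlip₁ x hx y hy h1) (hlip₂ x hx y hy h2)
  have hcount : ∀ t : Finset (ℝ × ℝ), t.Nonempty →
      (∀ y ∈ t, y ∈ ball x₀ ρ ∧ φ y = σ ∧ ψ y = τ) → ∀ x₁ ∈ ball x₀ ρ, 0 < gradDist φ ψ τ σ x₁ →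
      Real.log (gradDist φ ψ τ σ x₁) + t.card ≤ Real.log (6 * P ^ 4) := by
    intro t ht htK x₁ hx₁ hS₁
    have hnot : ∀ {x : ℝ × ℝ}, 0 < gradDist φ ψ τ σ x → x ∉ t := fun hpos hmem =>
      hpos.ne' (gradDist_eq_zero_iff.2 (htK _ hmem).2)
    have hne : ∀ {x : ℝ × ℝ}, 0 < gradDist φ ψ τ σ x → ∀ y ∈ t, x - y ≠ 0 := fun hpos y hy e =>
      hnot hpos (by rwa [sub_eq_zero.1 e])
    have hprodpos : ∀ {x : ℝ × ℝ}, 0 < gradDist φ ψ τ σ x →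
        0 < ∏ y ∈ t, poleWeight σ τ κ (x - y) := fun hpos =>
      Finset.prod_pos fun y hy => poleWeight_pos (hne hpos y hy)
    have hlog : ∀ {x : ℝ × ℝ}, 0 < gradDist φ ψ τ σ x →
        Real.log (gradDist φ ψ τ σ x * ∏ y ∈ t, poleWeight σ τ κ (x - y))
          = Real.log (gradDist φ ψ τ σ x) + ∑ y ∈ t, logBarrier σ τ κ (x - y) := by
      intro x hpos
      rw [Real.log_mul hpos.ne' (hprodpos hpos).ne',
        Real.log_prod fun y hy => (poleWeight_pos (hne hpos y hy)).ne']
      congr 1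
      exact Finset.sum_congr rfl fun y hy => log_poleWeight (hne hpos y hy)
    have hcont : ContinuousOn
        (fun x => gradDist φ ψ τ σ x * ∏ y ∈ t, poleWeight σ τ κ (x - y)) (closedBall x₀ R) := by
      refine continuousOn_mul_prod_poleWeight (C := 6 * P ^ 4)
        ((h.continuousOn_gradDist σ).mono (hRR₀.trans hR₀Ω)) fun y hy x hx => ?_
      rw [abs_of_nonneg (gradDist_nonneg _ _ _ _ _)]
      exact hgrad x hx y (htK y hy).1 (htK y hy).2.1 (htK y hy).2.2
    obtain ⟨x₂, hx₂, hmax⟩ := (isCompact_closedBall x₀ R).exists_isMaxOn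
      ⟨x₁, hρball hx₁⟩ hcont
    have hle : gradDist φ ψ τ σ x₁ * ∏ y ∈ t, poleWeight σ τ κ (x₁ - y)
        ≤ gradDist φ ψ τ σ x₂ * ∏ y ∈ t, poleWeight σ τ κ (x₂ - y) := hmax (hρball hx₁)
    have hpos₁ := mul_pos hS₁ (hprodpos hS₁)
    have hS₂ : 0 < gradDist φ ψ τ σ x₂ := by
      refine (gradDist_nonneg _ _ _ _ _).lt_of_ne fun e => ?_
      rw [← e, zero_mul] at hle
      linarith
    have hx₂bd : dist x₂ x₀ = R := by
      refine le_antisymm hx₂ (not_lt.1 fun hlt => ?_)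
      obtain ⟨b1, b2, b3, b4, b5⟩ := hbd x₂ (hRR₀ hx₂)
      refine h.not_isLocalMax_log_add_barrier (hR₀Ω (hRR₀ hx₂)) hB hτ hγ b1 b2 b3 b4 b5 hσ hS₂
        (by linarith) hC hK hκ ht (hnot hS₂) (fun y hy => hdist x₂ hx₂ y (htK y hy).1)
        (fun y hy => hlip₁ x₂ hx₂ y (htK y hy).1 (htK y hy).2.1)
        (fun y hy => hlip₂ x₂ hx₂ y (htK y hy).1 (htK y hy).2.2) ?_
      have hSc : ContinuousAt (gradDist φ ψ τ σ) x₂ :=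
        (h.continuousOn_gradDist σ).continuousAt (h.isOpen.mem_nhds (hR₀Ω (hRR₀ hx₂)))
      filter_upwards [isOpen_ball.mem_nhds (mem_ball.2 hlt), hSc.eventually (lt_mem_nhds hS₂)]
        with x hx hSx
      rw [← hlog hSx, ← hlog hS₂]
      exact Real.log_le_log (mul_pos hSx (hprodpos hSx)) (hmax (ball_subset_closedBall hx))
    have hlogle := Real.log_le_log hpos₁ hle
    rw [hlog hS₁, hlog hS₂] at hlogle
    have hupper : ∑ y ∈ t, logBarrier σ τ κ (x₂ - y) ≤ t.card • (-Real.log (R / 2) + 1) := by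
      refine Finset.sum_le_card_nsmul _ _ _ fun y hy => ?_
      have hy' := (htK y hy).1
      have h1 : R / 2 ≤ √(quadDist σ τ (x₂ - y)) := by
        refine le_trans ?_ (norm_le_sqrt_quadDist σ τ (x₂ - y))
        rw [← dist_eq_norm]
        have := dist_triangle_right x₂ x₀ y
        have h3 := dist_comm x₀ y
        rw [mem_ball] at hy'
        linarith
      have h2 := hdistκ x₂ hx₂ y hy'
      have h3 := Real.log_le_log (by positivity) h1
      rw [Real.log_sqrt (quadDist_nonneg _ _ _)] at h3
      rw [logBarrier]
      linarith
    have hlower : t.card • (-Real.log (R / 2) + 2) ≤ ∑ y ∈ t, logBarrier σ τ κ (x₁ - y) := by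
      refine Finset.card_nsmul_le_sum _ _ _ fun y hy => ?_
      have hy' := (htK y hy).1
      have h1 : √(quadDist σ τ (x₁ - y)) ≤ R / 2 * Real.exp (-2) := by
        refine (hrle _).trans ?_
        have : ‖x₁ - y‖ ≤ 2 * ρ := by
          rw [← dist_eq_norm]
          have := dist_triangle_right x₁ y x₀
          rw [mem_ball] at hx₁ hy'
          linarith
        calc 3 * B * ‖x₁ - y‖ ≤ 3 * B * (2 * ρ) := by gcongr
          _ = _ := by rw [hρ]; field_simp; norm_num
      have h0 := sqrt_quadDist_pos (σ := σ) (τ := τ) (hne hS₁ y hy)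
      have h3 := Real.log_le_log h0 h1
      rw [Real.log_sqrt (quadDist_nonneg _ _ _), Real.log_mul (by positivity) (by positivity),
        Real.log_exp] at h3
      rw [logBarrier]
      have : 0 ≤ κ * √(quadDist σ τ (x₁ - y)) := by positivity
      linarith
    have hS₂le : Real.log (gradDist φ ψ τ σ x₂) ≤ Real.log (6 * P ^ 4) := by
      obtain ⟨y, hy⟩ := ht
      refine Real.log_le_log hS₂ ((hgrad x₂ hx₂ y (htK y hy).1 (htK y hy).2.1
        (htK y hy).2.2).trans ?_)
      have h1 := hdist x₂ hx₂ y (htK y hy).1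
      have h0 := Real.sqrt_nonneg (quadDist σ τ (x₂ - y))
      have h2 : √(quadDist σ τ (x₂ - y)) * 1 ≤ √(quadDist σ τ (x₂ - y)) * (K * κ + C + 1) := by
        gcongr; linarith
      exact mul_le_of_le_one_right (by positivity) (pow_le_one₀ h0 (by linarith))
    rw [nsmul_eq_mul] at hupper hlower
    linarith
  filter_upwards [ball_mem_nhds x₀ hρ0] with x₁ hx₁
  rw [← gradDist_eq_zero_iff]
  by_contra hS
  have hS₁ := (gradDist_nonneg φ ψ τ σ x₁).lt_of_ne' hS
  have hinf := Set.Infinite.of_accPt (hacc.nhds_inter (ball_mem_nhds x₀ hρ0))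
  obtain ⟨n, hn⟩ := exists_nat_gt (Real.log (6 * P ^ 4) - Real.log (gradDist φ ψ τ σ x₁))
  obtain ⟨t, htK, hcard⟩ := hinf.exists_subset_card_eq (n + 1)
  have := hcount t (Finset.card_pos.1 (by omega)) (fun y hy => ⟨(htK hy).1, (htK hy).2⟩) x₁ hx₁ hS₁
  rw [hcard] at this
  push_cast at this
  linarith

end IsTranslatorGradient


theorem norm_sq_le_gradDist {φ ψ : ℝ × ℝ → ℝ} {τ c m : ℝ} {p : ℝ × ℝ} (hm : 0 ≤ m)
    (h : m ≤ |φ p - c| + |ψ p - τ|) : m ^ 2 / 2 ≤ gradDist φ ψ τ c p := by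
  have h1 : m ^ 2 ≤ (|φ p - c| + |ψ p - τ|) ^ 2 := by gcongr
  have h2 := sq_nonneg (|φ p - c| - |ψ p - τ|)
  have h3 := sq_abs (φ p - c)
  have h4 := sq_abs (ψ p - τ)
  have h5 := sq_nonneg (-τ * (φ p - c) + c * (ψ p - τ))
  rw [gradDist]
  nlinarith

namespace IsTranslatorGradient

variable {Ω : Set (ℝ × ℝ)} {φ ψ : ℝ × ℝ → ℝ} {τ γ : ℝ} {q : ℝ × ℝ} {σ : ℝ}

theorem not_isLocalMax_neg_log (h : IsTranslatorGradient Ω φ ψ τ γ) {x : ℝ × ℝ} (hx : x ∈ Ω)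
    {B C c : ℝ} (hB : 1 ≤ B) (hτ : |τ| ≤ B) (hγ : |γ| ≤ B) (hφ : |φ x| ≤ B) (hψ : |ψ x| ≤ B)
    (h11 : |pds φ x| ≤ B) (h12 : |pdt φ x| ≤ B) (h22 : |pdt ψ x| ≤ B) (hc : |c| ≤ B)
    (hC : C = 12000 * (20 * B ^ 3) ^ 7) (hS : 0 < gradDist φ ψ τ c x)
    (hr : 4 * C * ‖x - q‖ ≤ 1) :
    ¬ IsLocalMax (fun x => -Real.log (gradDist φ ψ τ c x) + C * quadDist 0 0 (x - q)) x := by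
  intro hm
  have hC0 : 0 < C := by rw [hC]; positivity
  obtain ⟨X₁, X₂, b, hj, hb⟩ := h.log_gradDist_estimate hx hB hτ hγ hφ hψ h11 h12 h22 hc hS
  rw [← hC] at hb
  have hjet : ∀ v : ℝ × ℝ, -(v.1 * X₁ + v.2 * X₂) + C * (v.1 * (2 * (x - q).1)
      + v.2 * (2 * (x - q).2)) = 0 ∧ -b v + C * (2 * (v.1 ^ 2 + v.2 ^ 2)) ≤ 0 := by
    intro v
    refine HasTwoJet.of_isLocalMax
      (((hj v).neg.add ((hasTwoJet_quadDist 0 0 (x - q) v).const_mul C)).congr_jet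
        (by ring) (by ring)) ?_
    have := isLocalMax_line hm v
    simpa only [add_sub_right_comm] using this
  have hz : 2 * C * ‖x - q‖ ≤ 1 / 2 := by linarith
  have hX : ∀ {X z : ℝ}, -X + C * (2 * z) = 0 → |z| ≤ ‖x - q‖ → |X| ≤ 1 / 2 := by
    intro X z h1 h2
    have : X = 2 * C * z := by linarith
    rw [this, abs_mul, abs_of_pos (by positivity : 0 < 2 * C)]
    exact (mul_le_mul_of_nonneg_left h2 (by positivity)).trans hz
  have hX₁ := hX (by simpa using (hjet (1, 0)).1) (norm_fst_le (x - q))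
  have hX₂ := hX (by simpa using (hjet (0, 1)).1) (norm_snd_le (x - q))
  have k1 := (hjet (1, 0)).2
  have k2 := (hjet (0, 1)).2
  have k3 := (hjet (-ψ x, φ x)).2
  have k4 : C * (|X₁| + |X₂| + 1) ≤ C * 2 := by gcongr; linarith
  have k5 : 0 ≤ C * (2 * ((-ψ x) ^ 2 + φ x ^ 2)) := by positivity
  norm_num at k1 k2
  linarith [(abs_le.1 hb).2]

theorem eventually_exists_of_not_accPt (h : IsTranslatorGradient Ω φ ψ τ γ) (hq : q ∈ Ω)
    (hφq : φ q = σ) (hψq : ψ q = τ) (hacc : ¬ AccPt q (𝓟 {x | φ x = σ ∧ ψ x = τ})) :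
    ∀ᶠ c in 𝓝 σ, ∃ p ∈ Ω, φ p = c ∧ ψ p = τ := by
  have hiso : ∀ᶠ y in 𝓝 q, y ≠ q → ¬ (φ y = σ ∧ ψ y = τ) := by
    rw [accPt_iff_frequently, not_frequently] at hacc
    filter_upwards [hacc] with y hy h1 h2
    exact hy ⟨h1, h2⟩
  obtain ⟨R₀, hR₀, hball⟩ := nhds_basis_closedBall.mem_iff.1 (hiso.and (h.isOpen.mem_nhds hq))
  have hR₀Ω : closedBall q R₀ ⊆ Ω := fun x hx => (hball hx).2
  obtain ⟨B, hB, hσB, hτ, hγ, hbd⟩ :=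
    h.exists_bound (isCompact_closedBall q R₀) hR₀Ω (|σ| + 1)
  obtain ⟨C, hC⟩ : ∃ C, C = 12000 * (20 * B ^ 3) ^ 7 := ⟨_, rfl⟩
  have hC0 : 0 < C := by rw [hC]; positivity
  obtain ⟨R, hR, hRR₀, hRC⟩ : ∃ R, 0 < R ∧ R ≤ R₀ ∧ 4 * C * R ≤ 1 := by
    refine ⟨min R₀ (1 / (4 * C)), by positivity, min_le_left _ _, ?_⟩
    calc 4 * C * min R₀ (1 / (4 * C)) ≤ 4 * C * (1 / (4 * C)) := by gcongr; exact min_le_right _ _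
      _ = 1 := by field_simp
  have hsub : closedBall q R ⊆ Ω := (closedBall_subset_closedBall hRR₀).trans hR₀Ω
  obtain ⟨m, hm, hmle⟩ : ∃ m, 0 < m ∧ ∀ x ∈ sphere q R, m ≤ |φ x - σ| + |ψ x - τ| := by
    refine (isCompact_sphere q R).exists_forall_le' (f := fun x => |φ x - σ| + |ψ x - τ|) ?_ ?_
    · have h1 := h.smooth_fst.continuousOn.mono (sphere_subset_closedBall.trans hsub)
      have h2 := h.smooth_snd.continuousOn.mono (sphere_subset_closedBall.trans hsub)
      exact (h1.sub continuousOn_const).abs.add (h2.sub continuousOn_const).abs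
    · intro x hx
      by_contra! hle
      have h1 := abs_nonneg (φ x - σ)
      have h2 := abs_nonneg (ψ x - τ)
      refine (hball (closedBall_subset_closedBall hRR₀ (sphere_subset_closedBall hx))).1 ?_
        ⟨sub_eq_zero.1 (abs_eq_zero.1 (by linarith)), sub_eq_zero.1 (abs_eq_zero.1 (by linarith))⟩
      rintro rfl
      exact hR.ne (by simpa using hx)
  have hsmall : ∀ᶠ c in 𝓝 σ,
      gradDist φ ψ τ c q < m ^ 2 / 8 * Real.exp (-(C * (3 * R) ^ 2)) := by
    have hcont : Continuous fun c => gradDist φ ψ τ c q := by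
      unfold gradDist; fun_prop
    refine hcont.continuousAt.eventually (gt_mem_nhds ?_)
    have h0 : gradDist φ ψ τ σ q = 0 := gradDist_eq_zero_iff.2 ⟨hφq, hψq⟩
    simp only [h0]
    positivity
  filter_upwards [hsmall, ball_mem_nhds σ one_pos, ball_mem_nhds σ (half_pos hm)]
    with c hcs hc1 hcm
  rw [mem_ball, Real.dist_eq] at hc1 hcm
  have hcB : |c| ≤ B := by
    have := abs_sub_abs_le_abs_sub c σ
    linarith
  by_contra! hno
  have hpos : ∀ x ∈ closedBall q R, 0 < gradDist φ ψ τ c x := fun x hx =>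
    (gradDist_nonneg φ ψ τ c x).lt_of_ne' fun e =>
      hno x (hsub hx) (gradDist_eq_zero_iff.1 e).1 (gradDist_eq_zero_iff.1 e).2
  have hcont : ContinuousOn
      (fun x => -Real.log (gradDist φ ψ τ c x) + C * quadDist 0 0 (x - q)) (closedBall q R) := by
    refine ((((h.continuousOn_gradDist c).mono hsub).log fun x hx => (hpos x hx).ne').neg).add ?_
    exact (continuous_const.mul ((continuous_quadDist 0 0).comp
      (continuous_id.sub continuous_const))).continuousOn
  obtain ⟨x, hx, hmax⟩ := (isCompact_closedBall q R).exists_isMaxOn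
    ⟨q, mem_closedBall_self hR.le⟩ hcont
  have hxn : ‖x - q‖ ≤ R := by rw [← dist_eq_norm]; exact hx
  have hbdry : x ∈ sphere q R := by
    refine le_antisymm hx (not_lt.1 fun hlt => ?_)
    obtain ⟨b1, b2, b3, b4, b5⟩ := hbd x (closedBall_subset_closedBall hRR₀ hx)
    refine h.not_isLocalMax_neg_log (q := q) (hsub hx) hB hτ hγ b1 b2 b3 b4 b5 hcB hC (hpos x hx)
      ((mul_le_mul_of_nonneg_left hxn (by positivity)).trans hRC) ?_
    filter_upwards [isOpen_ball.mem_nhds (mem_ball.2 hlt)] with y hy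
    exact hmax (ball_subset_closedBall hy)
  have hlow : m ^ 2 / 8 ≤ gradDist φ ψ τ c x := by
    have h1 := hmle x hbdry
    have h2 := abs_sub_le (φ x) c σ
    have := norm_sq_le_gradDist (p := x) (half_pos hm).le
      (by linarith : m / 2 ≤ |φ x - c| + |ψ x - τ|)
    linarith
  have hquad : quadDist 0 0 (x - q) ≤ (3 * R) ^ 2 := by
    have h1 := sqrt_quadDist_le (σ := 0) (τ := 0) le_rfl (by simp) (by simp) (x - q)
    rw [← Real.sqrt_le_left (by positivity)]
    linarith
  have hle : -Real.log (gradDist φ ψ τ c q) + C * quadDist 0 0 (q - q)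
      ≤ -Real.log (gradDist φ ψ τ c x) + C * quadDist 0 0 (x - q) :=
    hmax (mem_closedBall_self hR.le)
  have hq0 : quadDist 0 0 (q - q) = 0 := by simp [quadDist]
  have h1 := Real.log_lt_log (hpos q (mem_closedBall_self hR.le)) hcs
  rw [Real.log_mul (by positivity) (by positivity), Real.log_exp] at h1
  have h2 := Real.log_le_log (by positivity) hlow
  have h3 : C * quadDist 0 0 (x - q) ≤ C * (3 * R) ^ 2 := by gcongr
  rw [hq0] at hle
  linarith

theorem eq_of_accPt (h : IsTranslatorGradient Ω φ ψ τ γ) (hΩ : IsPreconnected Ω) (hq : q ∈ Ω)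
    (hacc : AccPt q (𝓟 {x | φ x = σ ∧ ψ x = τ})) : ∀ x ∈ Ω, φ x = σ ∧ ψ x = τ := by
  have hsub : Ω ⊆ interior {x | φ x = σ ∧ ψ x = τ} := by
    refine hΩ.subset_of_closure_inter_subset isOpen_interior
      ⟨q, hq, mem_interior_iff_mem_nhds.2 (h.eventually_eq_of_accPt hq hacc)⟩ ?_
    rintro x ⟨hx, hxΩ⟩
    by_contra hn
    refine hn (mem_interior_iff_mem_nhds.2 (h.eventually_eq_of_accPt hxΩ ?_))
    refine AccPt.mono ?_ (principal_mono.2 interior_subset)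
    rw [accPt_principal_iff_clusterPt, Set.sdiff_singleton_eq_self hn]
    exact mem_closure_iff_clusterPt.1 hx
  intro x hx
  have hxK : x ∈ {x | φ x = σ ∧ ψ x = τ} := interior_subset (hsub hx)
  exact hxK

theorem eventually_exists (h : IsTranslatorGradient Ω φ ψ τ γ) (hΩ : IsPreconnected Ω) (hq : q ∈ Ω)
    (hφq : φ q = σ) (hψq : ψ q = τ) (hne : ¬ ∀ x ∈ Ω, φ x = σ ∧ ψ x = τ) :
    ∀ᶠ c in 𝓝 σ, ∃ p ∈ Ω, φ p = c ∧ ψ p = τ :=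
  h.eventually_exists_of_not_accPt hq hφq hψq fun hacc => hne (h.eq_of_accPt hΩ hq hacc)

end IsTranslatorGradient

theorem exists_affine_of_partials_const {Ω : Set (ℝ × ℝ)} {u : ℝ × ℝ → ℝ} {σ τ : ℝ}
    (hΩ : IsOpen Ω) (hc : IsPreconnected Ω) (hu : DifferentiableOn ℝ u Ω)
    (h : ∀ x ∈ Ω, pds u x = σ ∧ pdt u x = τ) :
    ∃ c, ∀ x ∈ Ω, u x = σ * x.1 + τ * x.2 + c := by
  have hL : ∀ x : ℝ × ℝ, HasFDerivAt (fun x : ℝ × ℝ => σ * x.1 + τ * x.2)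
      (σ • ContinuousLinearMap.fst ℝ ℝ ℝ + τ • ContinuousLinearMap.snd ℝ ℝ ℝ) x := fun x =>
    (hasFDerivAt_fst.const_mul σ).add (hasFDerivAt_snd.const_mul τ)
  obtain ⟨c, hc⟩ := hΩ.exists_eq_add_of_fderiv_eq hc hu
    (fun x _ => (hL x).differentiableAt.differentiableWithinAt) fun x hx => by
      rw [(hL x).fderiv]
      ext <;> simp [fderiv_eq_partials, h x hx]
  exact ⟨c, hc⟩

theorem IsTranslatingGraph.isTranslatorGradient {θ τ : ℝ} {Ω : Set (ℝ × ℝ)} {u : ℝ × ℝ → ℝ}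
    {S : Set E3} (h : IsTranslatingGraph e1 (bθ θ) (vθ θ) Ω u S) (hτ : Real.sin θ = τ * Real.cos θ) :
    IsTranslatorGradient Ω (pds u) (pdt u) τ (-Real.cos θ) where
  isOpen := h.isOpen_dom
  smooth_fst := contDiffOn_pds h.isOpen_dom h.smooth
  smooth_snd := contDiffOn_pdt h.isOpen_dom h.smooth
  closed p hp := pds_pdt_comm h.isOpen_dom h.smooth hp
  pde p hp := by
    have h1 : ⟪e3, vθ θ⟫ = Real.sin θ := by
      simp [e3, e2, vθ, inner_add_right, EuclideanSpace.inner_single_left]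
    have h2 : ⟪e3, e1⟫ = 0 := by simp [e3, e1, EuclideanSpace.inner_single_left]
    have h3 : ⟪e3, bθ θ⟫ = Real.cos θ := by
      simp [e3, e2, bθ, inner_sub_right, EuclideanSpace.inner_single_left]
    have := h.pde p hp
    rw [h1, h2, h3, hτ] at this
    linear_combination this

theorem IsTranslatingGraph.subset_plane {θ σ τ : ℝ} {Ω : Set (ℝ × ℝ)} {u : ℝ × ℝ → ℝ}
    {S : Set E3} (h : IsTranslatingGraph e1 (bθ θ) (vθ θ) Ω u S)
    (hc : ∀ x ∈ Ω, pds u x = σ ∧ pdt u x = τ) :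
    ∃ (ν : E3) (c : ℝ), ν ≠ 0 ∧ S ⊆ {q : E3 | ⟪q, ν⟫ = c} := by
  obtain ⟨c, hu⟩ := exists_affine_of_partials_const h.isOpen_dom h.isConnected_dom.isPreconnected
    (h.smooth.differentiableOn (by simp)) hc
  have haa : ⟪e1, e1⟫ = 1 := by rw [real_inner_self_eq_norm_sq, h.norm_a, one_pow]
  have hbb : ⟪bθ θ, bθ θ⟫ = 1 := by rw [real_inner_self_eq_norm_sq, h.norm_b, one_pow]
  have hvv : ⟪vθ θ, vθ θ⟫ = 1 := by rw [real_inner_self_eq_norm_sq, h.norm_v, one_pow]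
  have hab := h.inner_ab
  have hav := h.inner_av
  have hbv := h.inner_bv
  have hba := (real_inner_comm (bθ θ) e1).symm.trans hab
  have hva := (real_inner_comm (vθ θ) e1).symm.trans hav
  have hvb := (real_inner_comm (vθ θ) (bθ θ)).symm.trans hbv
  refine ⟨vθ θ - σ • e1 - τ • bθ θ, c, fun h0 => ?_, ?_⟩
  · have : ⟪vθ θ, vθ θ - σ • e1 - τ • bθ θ⟫ = 1 := by
      simp only [inner_sub_right, real_inner_smul_right, hvv, hva, hvb]
      ring
    rw [h0, inner_zero_right] at this
    exact zero_ne_one this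
  · rw [h.graph_eq]
    rintro q ⟨p, hp, rfl⟩
    simp only [Set.mem_ofPred_eq, inner_sub_right, inner_add_left, real_inner_smul_right,
      real_inner_smul_left, haa, hbb, hvv, hab, hav, hbv, hba, hva, hvb, hu p hp]
    ring

theorem gaussMapθ_eq_iff_coords {θ : ℝ} {u : ℝ × ℝ → ℝ} {p : ℝ × ℝ} {ν : E3} :
    gaussMapθ θ u p = ν ↔
      (√(1 + pds u p ^ 2 + pdt u p ^ 2))⁻¹ * (-pds u p) = ν 0 ∧
      (√(1 + pds u p ^ 2 + pdt u p ^ 2))⁻¹ * (Real.cos θ + pdt u p * Real.sin θ) = ν 1 ∧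
      (√(1 + pds u p ^ 2 + pdt u p ^ 2))⁻¹ * (Real.sin θ - pdt u p * Real.cos θ) = ν 2 := by
  constructor
  · rintro rfl
    refine ⟨?_, ?_, ?_⟩ <;> simp [gaussMapθ, vθ, bθ, e1, e2, e3]
  · rintro ⟨h0, h1, h2⟩
    ext i
    fin_cases i
    · simpa [gaussMapθ, vθ, bθ, e1, e2, e3] using h0
    · simpa [gaussMapθ, vθ, bθ, e1, e2, e3] using h1
    · simpa [gaussMapθ, vθ, bθ, e1, e2, e3] using h2

theorem exists_slope_of_gaussMapθ {θ : ℝ} {u : ℝ × ℝ → ℝ} {p : ℝ × ℝ} {ν : E3}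
    (h : gaussMapθ θ u p = ν) (hν : ν 2 = 0) :
    Real.sin θ = pdt u p * Real.cos θ ∧ 0 < ν 1 * Real.cos θ ∧
      pds u p = -ν 0 / (ν 1 * Real.cos θ) := by
  obtain ⟨h0, h1, h2⟩ := gaussMapθ_eq_iff_coords.1 h
  have hr : 0 < (√(1 + pds u p ^ 2 + pdt u p ^ 2))⁻¹ := by positivity
  have hs : Real.sin θ = pdt u p * Real.cos θ := by
    rw [hν, mul_eq_zero] at h2
    linarith [h2.resolve_left hr.ne']
  have hy : ν 1 * Real.cos θ = (√(1 + pds u p ^ 2 + pdt u p ^ 2))⁻¹ := by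
    rw [← h1]
    have := Real.sin_sq_add_cos_sq θ
    have h3 : (Real.cos θ + pdt u p * Real.sin θ) * Real.cos θ = 1 := by
      linear_combination this - Real.sin θ * hs
    rw [mul_assoc, h3, mul_one]
  refine ⟨hs, hy ▸ hr, ?_⟩
  rw [hy, ← h0]
  field_simp

theorem gaussMapθ_eq_of_slope {θ τ : ℝ} {u : ℝ × ℝ → ℝ} {p : ℝ × ℝ} {ν : E3} (hnorm : ‖ν‖ = 1)
    (hν : ν 2 = 0) (hτ : Real.sin θ = τ * Real.cos θ) (hpos : 0 < ν 1 * Real.cos θ)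
    (hs : pds u p = -ν 0 / (ν 1 * Real.cos θ)) (ht : pdt u p = τ) : gaussMapθ θ u p = ν := by
  have hsq : ν 0 ^ 2 + ν 1 ^ 2 = 1 := by
    have := EuclideanSpace.real_norm_sq_eq ν
    rw [Fin.sum_univ_three, hnorm, hν] at this
    linarith
  have hcos : Real.cos θ ≠ 0 := fun h => by simp [h] at hpos
  have hν1 : ν 1 ≠ 0 := fun h => by simp [h] at hpos
  have hτ2 : (1 + τ ^ 2) * Real.cos θ ^ 2 = 1 := by
    have := Real.sin_sq_add_cos_sq θ
    rw [hτ] at this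
    linear_combination this
  have hroot : √(1 + pds u p ^ 2 + pdt u p ^ 2) = (ν 1 * Real.cos θ)⁻¹ := by
    rw [Real.sqrt_eq_iff_eq_sq (by positivity) (inv_pos.2 hpos).le, hs, ht]
    field_simp
    linear_combination ν 1 ^ 2 * hτ2 + hsq
  rw [gaussMapθ_eq_iff_coords, hroot, inv_inv, hs, ht, hν]
  refine ⟨?_, ?_, ?_⟩
  · field_simp
  · rw [hτ]
    linear_combination ν 1 * hτ2
  · rw [hτ]; ring

end HelperLemmas

/-- for a nonplanar complete connected translating graph in a direction `v_θ`,
the Gauss image of the zero set of the mean curvature is an open subset of the equator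
`E = {ν ∈ S² : ⟪ν, e₃⟫ = 0}`. -/
theorem stmt15 (θ : ℝ) (hθ : θ ∈ Set.Ico 0 π) (Ω : Set (ℝ × ℝ)) (u : ℝ × ℝ → ℝ) (S : Set E3)
    (hgraph : IsTranslatingGraph e1 (bθ θ) (vθ θ) Ω u S) (hcomplete : IsClosed S)
    (hnonplanar : ¬ ∃ (ν : E3) (c : ℝ), ν ≠ 0 ∧ S ⊆ {q : E3 | ⟪q, ν⟫ = c}) :
    IsOpen {ν : {ν : E3 // ‖ν‖ = 1 ∧ ⟪ν, e3⟫ = 0} | ∃ p ∈ Ω, gaussMapθ θ u p = (ν : E3)} := by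
  have hthird : ∀ ν : {ν : E3 // ‖ν‖ = 1 ∧ ⟪ν, e3⟫ = 0}, (ν : E3) 2 = 0 := fun ν => by
    simpa [e3, EuclideanSpace.inner_single_right] using ν.2.2
  have hcoord : ∀ i, Continuous fun ν : {ν : E3 // ‖ν‖ = 1 ∧ ⟪ν, e3⟫ = 0} => (ν : E3) i :=
    fun i => (EuclideanSpace.proj (𝕜 := ℝ) i).continuous.comp continuous_subtype_val
  rw [isOpen_iff_eventually]
  rintro ν ⟨q, hq, hqν⟩
  obtain ⟨hsin, hpos, hslope⟩ := exists_slope_of_gaussMapθ hqν (hthird ν)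
  have hcore := (hgraph.isTranslatorGradient hsin).eventually_exists
    hgraph.isConnected_dom.isPreconnected hq rfl rfl fun hc => hnonplanar (hgraph.subset_plane hc)
  rw [hslope] at hcore
  have hden := (hcoord 1).mul (continuous_const (y := Real.cos θ))
  have hcont := ((hcoord 0).neg.continuousAt (x := ν)).div hden.continuousAt hpos.ne'
  filter_upwards [hcont.eventually hcore, hden.continuousAt.eventually (lt_mem_nhds hpos)]
    with μ ⟨p, hp, hps, hpt⟩ hμ
  exact ⟨p, hp, gaussMapθ_eq_of_slope μ.2.1 (hthird μ) hsin hμ hps hpt⟩
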